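/- Let X be a random variable with density f belonging to the integrated Pearson family IP(μ; δ, β, γ) with δ ≤ 0, let n ≥ 1, and let g ∈ H^{∞,n}(X) (i.e., g ∈ H^{m,n}(X) for every m ≥ 0). Then the sequence (S_{m,n}(g))_{m≥0} is monotone in m (non-decreasing when n is even, non-increasing when n is odd) and converges to Var[g(X)] as m → ∞. -/

import Mathlib

open MeasureTheory ProbabilityTheory Finset Filter

noncomputable section

/-- Falling factorial `(x)_k = x (x-1) ⋯ (x-k+1)`, with `(x)_0 = 1`. -/
def fall (x : ℝ) (k : ℕ) : ℝ := ∏ j ∈ Finset.range k, (x - j)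

/-- Rising factorial `[x]_k = x (x+1) ⋯ (x+k-1)`, with `[x]_0 = 1`. -/
def rise (x : ℝ) (k : ℕ) : ℝ := ∏ j ∈ Finset.range k, (x + j)

/-- The product `∏_{j=a}^{a+len-1} (1 - j δ)` of `len` consecutive factors
(an empty product is `1`). -/
def pp (δ a : ℝ) (len : ℕ) : ℝ := ∏ j ∈ Finset.range len, (1 - (a + j) * δ)

/-- The open real interval with (possibly infinite) endpoints `α ω : EReal`. -/
def erealIoo (α ω : EReal) : Set ℝ := {x : ℝ | α < (x : EReal) ∧ (x : EReal) < ω}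

/-- `g` coincides on `J` with a polynomial of degree at most `d`. -/
def IsPolyOn (g : ℝ → ℝ) (J : Set ℝ) (d : ℕ) : Prop :=
  ∃ p : Polynomial ℝ, p.natDegree ≤ d ∧ ∀ x ∈ J, g x = p.eval x

/-- The quadratic `q(x) = δ x² + β x + γ` of a Pearson family. -/
def pq (δ β γ : ℝ) : ℝ → ℝ := fun x => δ * x ^ 2 + β * x + γ

/-- `P` is the distribution of a random variable with density `f` (w.r.t. Lebesgue
measure) belonging to the integrated Pearson family `IP(μ; δ, β, γ)`:
`μ` is the (finite) mean of `P`, `|δ|+|β|+|γ| > 0`, and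
`∫_{-∞}^x (μ - t) f(t) dt = q(x) f(x)` for all `x`. -/
def IsIntegratedPearson (P : Measure ℝ) (f : ℝ → ℝ) (μ δ β γ : ℝ) : Prop :=
  IsProbabilityMeasure P ∧
  (∀ x, 0 ≤ f x) ∧
  P = volume.withDensity (fun x => ENNReal.ofReal (f x)) ∧
  Integrable (fun x : ℝ => x) P ∧
  μ = ∫ x, x ∂P ∧
  0 < |δ| + |β| + |γ| ∧
  ∀ x : ℝ, (∫ t in Set.Iic x, (μ - t) * f t) = pq δ β γ x * f x

/-- Membership in the class `H^{m,n}(X)` for the distribution `P` of `X` with Pearson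
quadratic `q` and support `J`.  Here `gd k` plays the role of the `k`-th derivative
`g^{(k)}` of `g = gd 0` on `J`.  With `ℓ = max m n`:  `g ∈ C^{ℓ-1}(J)`
(encoded by `gd k` having derivative `gd (k+1)` at every point of `J` for `k+1 < ℓ`,
and `gd (ℓ-1)` continuous on `J`), `g^{(ℓ-1)}` is absolutely continuous on `J` with
a.e. derivative `g^{(ℓ)} = gd ℓ` (encoded by the fundamental theorem of calculus:
`gd ℓ` is locally integrable and `gd (ℓ-1)` is its integral on every subinterval of `J`),
and the moment conditions `E[q(X)^n (g^{(n)}(X))²] < ∞` and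
`E[q(X)^i |g^{(i)}(X)|] < ∞` for `n < i ≤ m` hold. -/
def MemH (P : Measure ℝ) (q : ℝ → ℝ) (J : Set ℝ) (m n : ℕ) (gd : ℕ → ℝ → ℝ) : Prop :=
  (∀ k, k + 1 < max m n → ∀ x ∈ J, HasDerivAt (gd k) (gd (k + 1) x) x) ∧
  (1 ≤ max m n → ContinuousOn (gd (max m n - 1)) J) ∧
  (1 ≤ max m n → ∀ a ∈ J, ∀ b ∈ J,
    IntervalIntegrable (gd (max m n)) volume a b ∧
      gd (max m n - 1) b - gd (max m n - 1) a = ∫ t in a..b, gd (max m n) t) ∧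
  Integrable (fun x => q x ^ n * (gd n x) ^ 2) P ∧
  ∀ i, n < i → i ≤ m → Integrable (fun x => q x ^ i * |gd i x|) P

/-- The variance bound `S_{m,n}(g)` of Theorem 2.1, for a Pearson distribution `P`
with quadratic `q` and parameter `δ`. -/
def Sbound (P : Measure ℝ) (δ : ℝ) (q : ℝ → ℝ) (m n : ℕ) (gd : ℕ → ℝ → ℝ) : ℝ :=
  (∑ i ∈ Finset.Icc 1 m,
      ((m.choose i : ℝ) * pp δ ((m : ℝ) + i) n /
          (fall ((m : ℝ) + n) i * (∫ x, q x ^ i ∂P) * pp δ ((i : ℝ) - 1) i *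
            pp δ (m : ℝ) n)) *
        (∫ x, q x ^ i * gd i x ∂P) ^ 2) +
    ∑ i ∈ Finset.Icc 1 n,
      (-1 : ℝ) ^ (i - 1) *
          ((n.choose i : ℝ) / (fall ((m : ℝ) + n) i * pp δ (m : ℝ) i)) *
        ∫ x, q x ^ i * (gd i x) ^ 2 ∂P

/-- Parseval for a total orthonormal sequence of functions. -/
theorem parseval_aux (P : Measure ℝ) (v : ℝ → ℝ) (hv : MemLp v 2 P) (e : ℕ → ℝ → ℝ)
    (he : ∀ k, MemLp (e k) 2 P)
    (horth : ∀ j k, ∫ x, e j x * e k x ∂P = if j = k then 1 else 0)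
    (htot : ∀ φ : ℝ → ℝ, MemLp φ 2 P → (∀ k, ∫ x, φ x * e k x ∂P = 0) → φ =ᵐ[P] 0) :
    HasSum (fun k => (∫ x, v x * e k x ∂P) ^ 2) (∫ x, v x ^ 2 ∂P) := by
  have hin : ∀ (a b : ℝ → ℝ) (ha : MemLp a 2 P) (hb : MemLp b 2 P),
      inner ℝ (ha.toLp a) (hb.toLp b) = ∫ x, a x * b x ∂P := by
    intro a b ha hb
    rw [L2.inner_def]
    apply integral_congr_ae
    filter_upwards [ha.coeFn_toLp, hb.coeFn_toLp] with x h1 h2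
    rw [h1, h2]
    simp [mul_comm]
  set E : ℕ → Lp ℝ 2 P := fun k => (he k).toLp (e k) with hE
  have hon : Orthonormal ℝ E := by
    rw [orthonormal_iff_ite]
    intro i j
    rw [hE]
    simp only [hin]
    exact horth i j
  have hbot : (Submodule.span ℝ (Set.range E))ᗮ = ⊥ := by
    rw [Submodule.eq_bot_iff]
    intro y hy
    have h2 : ∀ k, inner ℝ y (E k) = 0 := by
      intro k
      rw [real_inner_comm]
      exact (Submodule.mem_orthogonal _ _).1 hy _ (Submodule.subset_span ⟨k, rfl⟩)
    have hm : MemLp (y : ℝ → ℝ) 2 P := Lp.memLp y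
    have hyy : hm.toLp y = y := Lp.toLp_coeFn y hm
    have := htot y hm (fun k => by
      have := h2 k
      rw [← hyy, hE] at this
      simp only [hin] at this
      exact this)
    rw [← hyy]
    rw [MemLp.toLp_congr hm (MemLp.zero') this]
    rfl
  set b := HilbertBasis.mkOfOrthogonalEqBot hon hbot with hb
  have := b.hasSum_inner_mul_inner (hv.toLp v) (hv.toLp v)
  have hbk : ∀ k, b k = E k := fun k => by
    rw [hb, HilbertBasis.coe_mkOfOrthogonalEqBot]
  simp only [hbk, hE, hin] at this
  have h1 : (fun k => (∫ x, v x * e k x ∂P) ^ 2) =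
      fun i => (∫ x, v x * e i x ∂P) * ∫ x, e i x * v x ∂P := by
    funext k
    rw [sq]; congr 1
    exact integral_congr_ae (ae_of_all _ fun x => mul_comm _ _)
  have h2 : ∫ x, v x ^ 2 ∂P = ∫ x, v x * v x ∂P :=
    integral_congr_ae (ae_of_all _ fun x => sq _)
  rw [h1, h2]
  exact this

/-- Two finite measures with exponential moments and the same moments coincide. -/
theorem ext_of_moments (μ₁ μ₂ : Measure ℝ) [IsFiniteMeasure μ₁] [IsFiniteMeasure μ₂]
    (t : ℝ) (ht : 0 < t)
    (h1 : Set.Ioo (-t) t ⊆ integrableExpSet id μ₁)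
    (h2 : Set.Ioo (-t) t ⊆ integrableExpSet id μ₂)
    (hm : ∀ k : ℕ, ∫ x, x ^ k ∂μ₁ = ∫ x, x ^ k ∂μ₂) : μ₁ = μ₂ := by
  have h1' : Set.Ioo (-t) t ⊆ interior (integrableExpSet id μ₁) :=
    interior_maximal h1 isOpen_Ioo
  have h2' : Set.Ioo (-t) t ⊆ interior (integrableExpSet id μ₂) :=
    interior_maximal h2 isOpen_Ioo
  set U : Set ℂ := {z | z.re ∈ Set.Ioo (-t) t} with hU
  have hUc : Convex ℝ U :=
    (convex_Ioo (-t) t).linear_preimage Complex.reLm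
  have a1 : AnalyticOnNhd ℂ (complexMGF id μ₁) U := fun z hz => analyticAt_complexMGF (h1' hz)
  have a2 : AnalyticOnNhd ℂ (complexMGF id μ₂) U := fun z hz => analyticAt_complexMGF (h2' hz)
  have h0 : (0 : ℂ) ∈ U := by simp [hU, ht]
  have hev : complexMGF id μ₁ =ᶠ[nhds 0] complexMGF id μ₂ := by
    have f1 := (a1 0 h0).hasFPowerSeriesAt
    have f2 := (a2 0 h0).hasFPowerSeriesAt
    have hd : ∀ k, iteratedDeriv k (complexMGF id μ₁) 0 = iteratedDeriv k (complexMGF id μ₂) 0 := by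
      intro k
      rw [iteratedDeriv_complexMGF (h1' h0), iteratedDeriv_complexMGF (h2' h0)]
      have := hm k
      have e : ∀ μ : Measure ℝ, (∫ x, ((id x : ℝ) : ℂ) ^ k * Complex.exp (0 * ((id x : ℝ) : ℂ)) ∂μ)
          = ((∫ x, x ^ k ∂μ : ℝ) : ℂ) := by
        intro μ
        rw [← integral_complex_ofReal]
        congr 1
        funext x
        simp
      rw [e, e, this]
    simp only [hd] at f1
    replace f1 : HasFPowerSeriesAt _ _ _ := f1
    have f3 := HasFPowerSeriesAt.sub f1 f2
    rw [sub_self] at f3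
    filter_upwards [f3.eventually_eq_zero] with z hz
    exact sub_eq_zero.1 hz
  have heq := a1.eqOn_of_preconnected_of_eventuallyEq a2 hUc.isPreconnected h0 hev
  apply Measure.ext_of_charFun
  funext s
  rw [← complexMGF_id_mul_I, ← complexMGF_id_mul_I]
  apply heq
  simp [hU, ht]

/-- Completeness of polynomials under exponential integrability. -/
theorem complete_aux (P : Measure ℝ) [IsFiniteMeasure P] (ψ : ℝ → ℝ) (t : ℝ) (ht : 0 < t)
    (hψm : AEStronglyMeasurable ψ P)
    (hIntg : Integrable (fun x => Real.exp (t * |x|) * ψ x) P)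
    (hmom : ∀ k : ℕ, ∫ x, ψ x * x ^ k ∂P = 0) : ψ =ᵐ[P] 0 := by
  have hdom : ∀ F : ℝ → ℝ, Measurable F → ∀ C : ℝ, (∀ x, |F x| ≤ C * Real.exp (t * |x|)) →
      Integrable (fun x => ψ x * F x) P := by
    intro F hF C hC
    refine (hIntg.norm.const_mul C).mono' (hψm.mul hF.aestronglyMeasurable) (ae_of_all _ fun x => ?_)
    simp only [norm_mul, Real.norm_eq_abs, Real.abs_exp]
    nlinarith [hC x, abs_nonneg (ψ x), mul_le_mul_of_nonneg_left (hC x) (abs_nonneg (ψ x))]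
  have hmeas : ∀ s : ℝ, AEMeasurable (fun x => ENNReal.ofReal (s * ψ x)) P := fun s =>
    (hψm.aemeasurable.const_mul s).ennreal_ofReal
  have hpos : ∀ (s : ℝ), |s| = 1 → ∀ F : ℝ → ℝ, Integrable (fun x => ψ x * F x) P →
      Measurable F → Integrable (fun x => max (s * ψ x) 0 * F x) P := by
    intro s hs F hF hFm
    refine hF.norm.mono' ?_ (ae_of_all _ fun x => ?_)
    · exact (((hψm.aemeasurable.const_mul s).max aemeasurable_const).mul
        hFm.aemeasurable).aestronglyMeasurable
    · simp only [norm_mul, Real.norm_eq_abs]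
      apply mul_le_mul_of_nonneg_right _ (abs_nonneg _)
      have : |s * ψ x| = |ψ x| := by rw [abs_mul, hs, one_mul]
      rw [abs_of_nonneg (le_max_right _ _), ← this]
      exact max_le (le_abs_self _) (abs_nonneg _)
  set ν : ℝ → Measure ℝ := fun s => P.withDensity (fun x => ENNReal.ofReal (s * ψ x)) with hν
  have hψ : Integrable ψ P := by
    have := hdom (fun _ => 1) measurable_const 1 (fun x => by
      simp only [abs_one, one_mul]; exact Real.one_le_exp (by positivity))
    simpa using this
  have hI : ∀ (s : ℝ) (F : ℝ → ℝ), ∫ x, F x ∂(ν s) = ∫ x, max (s * ψ x) 0 * F x ∂P := by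
    intro s F
    rw [hν]
    simp only
    rw [integral_withDensity_eq_integral_toReal_smul₀ (hmeas s) (by simp)]
    simp [ENNReal.toReal_ofReal', smul_eq_mul]
  have hfin : ∀ s, IsFiniteMeasure (ν s) := fun s =>
    isFiniteMeasure_withDensity_ofReal (hψ.const_mul s).2
  have hexp : ∀ s, |s| = 1 → Set.Ioo (-t) t ⊆ integrableExpSet id (ν s) := by
    intro s hs u hu
    simp only [integrableExpSet, Set.mem_ofPred_eq, id]
    rw [hν]
    simp only
    rw [integrable_withDensity_iff_integrable_smul₀' (hmeas s) (by simp)]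
    simp only [ENNReal.toReal_ofReal', smul_eq_mul]
    apply hpos s hs _ _ (by fun_prop)
    apply hdom _ (by fun_prop) 1
    intro x
    rw [Real.abs_exp, one_mul]
    apply Real.exp_le_exp.2
    calc u * x ≤ |u * x| := le_abs_self _
      _ = |u| * |x| := abs_mul _ _
      _ ≤ t * |x| := mul_le_mul_of_nonneg_right (abs_lt.2 hu).le (abs_nonneg _)
  have hmm : ∀ k : ℕ, ∫ x, x ^ k ∂(ν 1) = ∫ x, x ^ k ∂(ν (-1)) := by
    intro k
    have hk : Integrable (fun x => ψ x * x ^ k) P := by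
      apply hdom _ (by fun_prop) (k.factorial / t ^ k)
      intro x
      have := Real.pow_div_factorial_le_exp (t * |x|) (by positivity) k
      rw [abs_pow, div_mul_eq_mul_div, le_div_iff₀ (by positivity)]
      rw [div_le_iff₀ (by positivity), mul_pow] at this
      linarith
    rw [hI, hI, ← sub_eq_zero, ← integral_sub (hpos 1 (by simp) _ hk (by fun_prop))
      (hpos (-1) (by simp) _ hk (by fun_prop))]
    refine Eq.trans ?_ (hmom k)
    congr 1
    funext x
    rw [← sub_mul]
    congr 1
    rcases le_total (ψ x) 0 with h | h
    · rw [max_eq_right (by linarith), max_eq_left (by linarith)]; ring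
    · rw [max_eq_left (by linarith), max_eq_right (by linarith)]; ring
  have := hfin 1
  have := hfin (-1)
  have heq := ext_of_moments (ν 1) (ν (-1)) t ht (hexp 1 (by simp)) (hexp (-1) (by simp)) hmm
  rw [hν] at heq
  simp only at heq
  rw [withDensity_eq_iff_of_sigmaFinite (hmeas 1) (hmeas (-1))] at heq
  filter_upwards [heq] with x hx
  have := congrArg ENNReal.toReal hx
  rw [ENNReal.toReal_ofReal', ENNReal.toReal_ofReal'] at this
  simp only [Pi.zero_apply]
  rcases le_total (ψ x) 0 with h | h
  · rw [max_eq_right (by linarith), max_eq_left (by linarith)] at this; linarith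
  · rw [max_eq_left (by linarith), max_eq_right (by linarith)] at this; linarith

/-- Eigenvalues `λ_k = k (1 - (k-1) δ)`. -/
def lam (δ : ℝ) (k : ℕ) : ℝ := (k : ℝ) * (1 - ((k : ℝ) - 1) * δ)

/-- Newton basis polynomials `∏_{j<i} (y - λ_j)`. -/
def newt (δ : ℝ) (i : ℕ) (y : ℝ) : ℝ := ∏ j ∈ Finset.range i, (y - lam δ j)

/-- The factor `∏_{j=1}^n (1 - λ_k/λ_{m+j})`. -/
def rfac (δ : ℝ) (m n : ℕ) (y : ℝ) : ℝ := ∏ j ∈ Finset.range n, (1 - y / lam δ (m + 1 + j))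

/-- The coefficients `b_i`. -/
def bco (δ : ℝ) (m n i : ℕ) : ℝ :=
  (n.choose i : ℝ) / (fall ((m : ℝ) + n) i * pp δ (m : ℝ) i)

theorem one_sub_pos {δ : ℝ} (hδ : δ ≤ 0) {a : ℝ} (ha : 0 ≤ a) : 0 < 1 - a * δ := by
  nlinarith [mul_nonneg ha (neg_nonneg.2 hδ)]

theorem pp_pos {δ : ℝ} (hδ : δ ≤ 0) {a : ℝ} (ha : 0 ≤ a) (l : ℕ) : 0 < pp δ a l :=
  Finset.prod_pos fun j _ => one_sub_pos hδ (by positivity)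

theorem lam_pos {δ : ℝ} (hδ : δ ≤ 0) (k : ℕ) : 0 < lam δ (k + 1) := by
  unfold lam
  have := one_sub_pos hδ (Nat.cast_nonneg (α := ℝ) k)
  push_cast
  rw [add_sub_cancel_right]
  positivity

theorem lam_mono {δ : ℝ} (hδ : δ ≤ 0) : Monotone (lam δ) := by
  apply monotone_nat_of_le_succ
  intro k
  have := one_sub_pos hδ (a := 2 * (k : ℝ)) (by positivity)
  unfold lam
  push_cast
  nlinarith

theorem lam_nonneg {δ : ℝ} (hδ : δ ≤ 0) (k : ℕ) : 0 ≤ lam δ k := by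
  have := lam_mono hδ (Nat.zero_le k)
  simpa [lam] using this

theorem fall_mul_pp (δ : ℝ) (k i : ℕ) :
    fall (k : ℝ) i * pp δ ((k : ℝ) - 1) i = newt δ i (lam δ k) := by
  unfold fall pp newt lam
  rw [← Finset.prod_mul_distrib]
  apply Finset.prod_congr rfl
  intro j _
  ring

theorem fall_succ_left (x : ℝ) (k : ℕ) : fall (x + 1) (k + 1) = (x + 1) * fall x k := by
  unfold fall
  rw [Finset.prod_range_succ']
  push_cast
  rw [sub_zero, mul_comm]
  congr 1
  apply Finset.prod_congr rfl
  intro j _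
  ring

theorem fall_succ_right (x : ℝ) (k : ℕ) : fall x (k + 1) = fall x k * (x - k) := by
  unfold fall
  rw [Finset.prod_range_succ]

theorem fall_pos {m n i : ℕ} (h : i ≤ m + n) : 0 < fall ((m : ℝ) + n) i := by
  apply Finset.prod_pos
  intro j hj
  have : j < m + n := lt_of_lt_of_le (Finset.mem_range.1 hj) h
  have : (j : ℝ) < m + n := by exact_mod_cast this
  linarith

theorem pp_succ_left (δ a : ℝ) (k : ℕ) : pp δ a (k + 1) = (1 - a * δ) * pp δ (a + 1) k := by
  unfold pp
  rw [Finset.prod_range_succ', mul_comm]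
  push_cast
  rw [add_zero]
  congr 1
  apply Finset.prod_congr rfl
  intro j _
  ring

theorem pp_succ_right (δ a : ℝ) (k : ℕ) : pp δ a (k + 1) = pp δ a k * (1 - (a + k) * δ) := by
  unfold pp
  rw [Finset.prod_range_succ]

theorem bco_zero (δ : ℝ) (m n : ℕ) : bco δ m n 0 = 1 := by
  simp [bco, fall, pp]

theorem bco_rec0 {δ : ℝ} (m n : ℕ) :
    lam δ (m + 1) * bco δ m (n + 1) 0 = (lam δ (m + 1) - lam δ 0) * bco δ (m + 1) n 0 := by
  rw [bco_zero, bco_zero]; simp [lam]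

theorem bco_rec {δ : ℝ} (hδ : δ ≤ 0) (m n i : ℕ) (hi : i ≤ n) :
    lam δ (m + 1) * bco δ m (n + 1) (i + 1) =
      (lam δ (m + 1) - lam δ (i + 1)) * bco δ (m + 1) n (i + 1) + bco δ (m + 1) n i := by
  have hch : ((n.choose (i + 1) : ℝ)) * (i + 1) = n.choose i * (n - i) := by
    have := Nat.choose_succ_right_eq n i
    have h2 : ((n - i : ℕ) : ℝ) = (n : ℝ) - i := by rw [Nat.cast_sub hi]
    rw [← h2]
    exact_mod_cast this
  have hch2 : (((n + 1).choose (i + 1) : ℕ) : ℝ) = n.choose i + n.choose (i + 1) := by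
    rw [Nat.choose_succ_succ]; push_cast; ring
  have hM : (((m + 1 : ℕ) : ℝ) + n) = (m : ℝ) + ((n + 1 : ℕ) : ℝ) := by push_cast; ring
  unfold bco
  rw [hM, hch2]
  have f0 : 0 < fall ((m : ℝ) + ((n + 1 : ℕ) : ℝ)) i := fall_pos (by omega)
  have f1 : 0 < fall ((m : ℝ) + ((n + 1 : ℕ) : ℝ)) (i + 1) := fall_pos (by omega)
  have f2 := fall_succ_right ((m : ℝ) + ((n + 1 : ℕ) : ℝ)) i
  have f3 : 0 < (m : ℝ) + ((n + 1 : ℕ) : ℝ) - i := by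
    have : (i : ℝ) ≤ n := by exact_mod_cast hi
    push_cast; have := Nat.cast_nonneg (α := ℝ) m; linarith
  have p1 : pp δ (m : ℝ) (i + 1) = (1 - m * δ) * pp δ ((m + 1 : ℕ) : ℝ) i := by
    rw [pp_succ_left]; push_cast; rfl
  have p2 : pp δ ((m + 1 : ℕ) : ℝ) (i + 1) =
      pp δ ((m + 1 : ℕ) : ℝ) i * (1 - ((m + 1 : ℕ) + i) * δ) := pp_succ_right _ _ _
  have q0 : 0 < pp δ ((m + 1 : ℕ) : ℝ) i := pp_pos hδ (by positivity) i
  have q1 : 0 < 1 - (m : ℝ) * δ := one_sub_pos hδ (by positivity)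
  have q2 : 0 < 1 - (((m + 1 : ℕ) : ℝ) + i) * δ := one_sub_pos hδ (by positivity)
  have hl : lam δ (m + 1) = (m + 1) * (1 - m * δ) := by unfold lam; push_cast; ring
  have hl2 : lam δ (m + 1) - lam δ (i + 1) = (m - i) * (1 - (((m + 1 : ℕ) : ℝ) + i) * δ) := by
    unfold lam; push_cast; ring
  rw [hl2, hl, p1, p2, f2]
  set F := fall ((m : ℝ) + ((n + 1 : ℕ) : ℝ)) i
  set G := pp δ ((m + 1 : ℕ) : ℝ) i
  set Q1 := 1 - (m : ℝ) * δ
  set Q2 := 1 - (((m + 1 : ℕ) : ℝ) + i) * δ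
  set Z := (m : ℝ) + ((n + 1 : ℕ) : ℝ) - i with hZ
  have hZ' : Z = m + (n + 1) - i := by rw [hZ]; push_cast; ring
  have e1 : (m + 1) * Q1 * (((n.choose i : ℝ) + n.choose (i + 1)) / (F * Z * (Q1 * G))) =
      ((m + 1) * ((n.choose i : ℝ) + n.choose (i + 1))) / (F * Z * G) := by
    field_simp
  have e2 : (m - i) * Q2 * ((n.choose (i + 1) : ℝ) / (F * Z * (G * Q2))) =
      ((m - i) * (n.choose (i + 1) : ℝ)) / (F * Z * G) := by
    field_simp
  have e3 : (n.choose i : ℝ) / (F * G) = ((n.choose i : ℝ) * Z) / (F * Z * G) := by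
    field_simp
  rw [e1, e2, e3, ← add_div]
  congr 1
  rw [hZ']
  linear_combination hch

/-- Saalschütz-type identity. -/
theorem saal {δ : ℝ} (hδ : δ ≤ 0) (n : ℕ) : ∀ (m : ℕ) (y : ℝ),
    ∑ i ∈ Finset.range (n + 1), (-1 : ℝ) ^ i * bco δ m n i * newt δ i y = rfac δ m n y := by
  induction n with
  | zero => intro m y; simp [bco, fall, pp, newt, rfac]
  | succ n ih =>
    intro m y
    have hl := lam_pos hδ m
    have hr : rfac δ m (n + 1) y = (1 - y / lam δ (m + 1)) * rfac δ (m + 1) n y := by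
      unfold rfac
      rw [Finset.prod_range_succ', mul_comm]
      congr 1
      apply Finset.prod_congr rfl
      intro j _
      rw [show m + 1 + (j + 1) = m + 1 + 1 + j by ring]
    rw [hr, ← ih (m + 1) y]
    have h1 : (1 - y / lam δ (m + 1)) = (lam δ (m + 1) - y) / lam δ (m + 1) := by
      field_simp
    rw [h1, div_mul_eq_mul_div, eq_div_iff hl.ne', mul_comm _ (lam δ (m + 1)), Finset.mul_sum,
      Finset.mul_sum]
    have key : ∀ i, (lam δ (m + 1) - y) * ((-1 : ℝ) ^ i * bco δ (m + 1) n i * newt δ i y) =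
        (-1 : ℝ) ^ i * ((lam δ (m + 1) - lam δ i) * bco δ (m + 1) n i) * newt δ i y
        + (-1 : ℝ) ^ (i + 1) * bco δ (m + 1) n i * newt δ (i + 1) y := by
      intro i
      have : newt δ (i + 1) y = newt δ i y * (y - lam δ i) := by
        unfold newt; rw [Finset.prod_range_succ]
      rw [this]; ring
    rw [Finset.sum_congr rfl (fun i _ => key i), Finset.sum_add_distrib]
    have h2 : ∑ i ∈ Finset.range (n + 1),
        (-1 : ℝ) ^ i * ((lam δ (m + 1) - lam δ i) * bco δ (m + 1) n i) * newt δ i y =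
        ∑ i ∈ Finset.range (n + 1 + 1),
        (-1 : ℝ) ^ i * ((lam δ (m + 1) - lam δ i) * bco δ (m + 1) n i) * newt δ i y := by
      rw [Finset.sum_range_succ _ (n + 1)]
      simp [bco]
    rw [h2, Finset.sum_range_succ', Finset.sum_range_succ' _ (n + 1), add_right_comm,
      ← Finset.sum_add_distrib]
    congr 1
    · apply Finset.sum_congr rfl
      intro i hi
      have := bco_rec hδ m n i (by simpa [Nat.lt_succ_iff] using hi)
      linear_combination (-1 : ℝ) ^ (i + 1) * newt δ (i + 1) y * this
    · have := bco_rec0 (δ := δ) m n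
      linear_combination (-1 : ℝ) ^ 0 * newt δ 0 y * this

theorem choose_mul_factorial (m k : ℕ) : (m.choose k : ℝ) * k.factorial = fall (m : ℝ) k := by
  induction k generalizing m with
  | zero => simp [fall]
  | succ k ih =>
    rw [fall_succ_right, ← ih]
    rcases le_or_gt k m with h | h
    · have := Nat.choose_succ_right_eq m k
      have h2 : ((m.choose (k + 1) : ℕ) : ℝ) * (k + 1) = m.choose k * ((m : ℝ) - k) := by
        rw [← Nat.cast_sub h]; exact_mod_cast this
      rw [Nat.factorial_succ]; push_cast
      linear_combination (k.factorial : ℝ) * h2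
    · rw [Nat.choose_eq_zero_of_lt h, Nat.choose_eq_zero_of_lt (by omega)]; simp

theorem aco_eq {δ : ℝ} (hδ : δ ≤ 0) (m n k : ℕ) (hk : k ≤ m) :
    (m.choose k : ℝ) * k.factorial * pp δ ((m : ℝ) + k) n / (fall ((m : ℝ) + n) k * pp δ (m : ℝ) n)
      = rfac δ m n (lam δ k) := by
  rw [choose_mul_factorial]
  induction n with
  | zero =>
    have := fall_pos (m := m) (n := 0) (i := k) (by omega)
    simp only [Nat.cast_zero, add_zero] at this
    simp [pp, rfac]
    exact this.ne'
  | succ n ih =>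
    have hr : rfac δ m (n + 1) (lam δ k) =
        rfac δ m n (lam δ k) * (1 - lam δ k / lam δ (m + 1 + n)) := by
      unfold rfac; rw [Finset.prod_range_succ]
    rw [hr, ← ih, pp_succ_right, pp_succ_right]
    have f0 : 0 < fall ((m : ℝ) + n) k := fall_pos (by omega)
    have f1 : 0 < fall ((m : ℝ) + (n + 1 : ℕ)) k := fall_pos (by omega)
    have f2 : fall ((m : ℝ) + (n + 1 : ℕ)) k * ((m : ℝ) + n + 1 - k) =
        ((m : ℝ) + n + 1) * fall ((m : ℝ) + n) k := by
      have h1 := fall_succ_right ((m : ℝ) + n + 1) k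
      rw [fall_succ_left] at h1
      push_cast
      rw [← add_assoc]
      exact h1.symm
    have hkm : (k : ℝ) ≤ m := by exact_mod_cast hk
    have hn0 := Nat.cast_nonneg (α := ℝ) n
    have q0 : 0 < pp δ (m : ℝ) n := pp_pos hδ (by positivity) n
    have q2 : 0 < 1 - ((m : ℝ) + n) * δ := one_sub_pos hδ (by positivity)
    have l1 : lam δ (m + 1 + n) = ((m : ℝ) + n + 1) * (1 - ((m : ℝ) + n) * δ) := by
      unfold lam; push_cast; ring
    have l0 : 0 < lam δ (m + 1 + n) := by
      rw [show m + 1 + n = m + n + 1 by ring]; exact lam_pos hδ _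
    have l2 : 1 - lam δ k / lam δ (m + 1 + n) =
        ((m : ℝ) + n + 1 - k) * (1 - ((m : ℝ) + k + n) * δ) /
          (((m : ℝ) + n + 1) * (1 - ((m : ℝ) + n) * δ)) := by
      rw [← l1]
      rw [eq_div_iff l0.ne', sub_mul, div_mul_cancel₀ _ l0.ne', l1]
      unfold lam; ring
    have hx : (0 : ℝ) < (m : ℝ) + n + 1 := by positivity
    rw [l2, div_mul_div_comm, div_eq_div_iff (by positivity) (by positivity)]
    linear_combination (-(fall (m : ℝ) k * pp δ ((m : ℝ) + k) n * (1 - ((m : ℝ) + k + n) * δ) *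
      pp δ (m : ℝ) n * (1 - ((m : ℝ) + n) * δ))) * f2

/-- `∏_{j=1}^n (y/λ_{m+j} - 1)⁺`. -/
def rho (δ : ℝ) (m n : ℕ) (y : ℝ) : ℝ :=
  ∏ j ∈ Finset.range n, max (y / lam δ (m + 1 + j) - 1) 0

theorem rho_nonneg (δ : ℝ) (m n : ℕ) (y : ℝ) : 0 ≤ rho δ m n y :=
  Finset.prod_nonneg fun _ _ => le_max_right _ _

theorem lam_pos' {δ : ℝ} (hδ : δ ≤ 0) (m j : ℕ) : 0 < lam δ (m + 1 + j) := by
  rw [show m + 1 + j = m + j + 1 by ring]; exact lam_pos hδ _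

theorem rho_anti {δ : ℝ} (hδ : δ ≤ 0) {m m' : ℕ} (h : m ≤ m') (n k : ℕ) :
    rho δ m' n (lam δ k) ≤ rho δ m n (lam δ k) := by
  apply Finset.prod_le_prod
  · intro j _; exact le_max_right _ _
  · intro j _
    apply max_le_max _ le_rfl
    apply sub_le_sub_right
    apply div_le_div_of_nonneg_left (lam_nonneg hδ k) (lam_pos' hδ m j)
    exact lam_mono hδ (by omega)

theorem rho_of_le {δ : ℝ} (hδ : δ ≤ 0) {m n k : ℕ} (hn : 1 ≤ n) (h : k ≤ m + n) :
    rho δ m n (lam δ k) = 0 := by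
  apply Finset.prod_eq_zero (i := n - 1) (Finset.mem_range.2 (by omega))
  apply max_eq_right
  rw [sub_nonpos, div_le_one (lam_pos' hδ _ _)]
  exact lam_mono hδ (by omega)

theorem rho_of_lt {δ : ℝ} (hδ : δ ≤ 0) {m n k : ℕ} (hn : 1 ≤ n) (h : m < k) :
    rfac δ m n (lam δ k) = (-1) ^ n * rho δ m n (lam δ k) := by
  rcases le_or_gt k (m + n) with h1 | h1
  · rw [rho_of_le hδ hn h1, mul_zero]
    apply Finset.prod_eq_zero (i := k - m - 1) (Finset.mem_range.2 (by omega))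
    rw [show m + 1 + (k - m - 1) = k by omega, div_self, sub_self]
    obtain ⟨k', rfl⟩ : ∃ k', k = k' + 1 := ⟨k - 1, by omega⟩
    exact (lam_pos hδ k').ne'
  · have : ((-1 : ℝ)) ^ n = ∏ _j ∈ Finset.range n, (-1 : ℝ) := by simp
    unfold rfac rho
    rw [this, ← Finset.prod_mul_distrib]
    apply Finset.prod_congr rfl
    intro j hj
    have hj := Finset.mem_range.1 hj
    rw [max_eq_left]
    · ring
    · rw [sub_nonneg, one_le_div (lam_pos' hδ _ _)]
      exact lam_mono hδ (by omega)

theorem sum_Icc_one (n : ℕ) (F : ℕ → ℝ) :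
    ∑ i ∈ Finset.Icc 1 n, F i = ∑ i ∈ Finset.range n, F (i + 1) := by
  induction n with
  | zero => simp
  | succ n ih => rw [Finset.sum_Icc_succ_top (by omega), ih, Finset.sum_range_succ]

/-- Abstract conclusion from the Parseval identities. -/
theorem abstract_main {δ : ℝ} (hδ : δ ≤ 0) (n : ℕ) (hn : 1 ≤ n) (c A : ℕ → ℝ)
    (hc : ∀ k, 0 ≤ c k)
    (hA : ∀ i ≤ n, HasSum (fun k => c k * newt δ i (lam δ k)) (A i))
    (S : ℕ → ℝ)
    (hS : ∀ m, S m = ∑ k ∈ Finset.Icc 1 m, c k * rfac δ m n (lam δ k) +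
      ∑ i ∈ Finset.Icc 1 n, (-1 : ℝ) ^ (i - 1) * bco δ m n i * A i) :
    (Even n → Monotone S) ∧ (Odd n → Antitone S) ∧ Tendsto S atTop (nhds (A 0 - c 0)) := by
  have hr : ∀ m, HasSum (fun k => c k * rfac δ m n (lam δ k))
      (∑ i ∈ Finset.range (n + 1), (-1 : ℝ) ^ i * bco δ m n i * A i) := by
    intro m
    have := hasSum_sum (s := Finset.range (n + 1))
      (f := fun i k => (-1 : ℝ) ^ i * bco δ m n i * (c k * newt δ i (lam δ k)))
      (a := fun i => (-1 : ℝ) ^ i * bco δ m n i * A i)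
      (fun i hi => (hA i (by simpa [Nat.lt_succ_iff] using hi)).mul_left _)
    convert this using 2 with k
    rw [← saal hδ n m, Finset.mul_sum]
    apply Finset.sum_congr rfl
    intro i _; ring
  have hsum2 : ∀ m, ∑ i ∈ Finset.range (n + 1), (-1 : ℝ) ^ i * bco δ m n i * A i =
      A 0 - ∑ i ∈ Finset.Icc 1 n, (-1 : ℝ) ^ (i - 1) * bco δ m n i * A i := by
    intro m
    rw [Finset.sum_range_succ', bco_zero, sum_Icc_one, sub_eq_add_neg (A 0), add_comm,
      ← Finset.sum_neg_distrib]
    congr 1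
    · ring
    · apply Finset.sum_congr rfl
      intro i _
      rw [Nat.add_sub_cancel, pow_succ]; ring
  have hρ : ∀ m, HasSum (fun k => c k * rho δ m n (lam δ k)) ((-1) ^ n * ((A 0 - c 0) - S m)) := by
    intro m
    have hfin : HasSum (fun k => if k ∈ Finset.range (m + 1) then c k * rfac δ m n (lam δ k) else 0)
        (∑ k ∈ Finset.range (m + 1), c k * rfac δ m n (lam δ k)) := by
      have := hasSum_sum_of_ne_finset_zero (L := SummationFilter.unconditional ℕ) (s := Finset.range (m + 1))
        (f := fun k => if k ∈ Finset.range (m + 1) then c k * rfac δ m n (lam δ k) else 0)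
        (fun k hk => by simp only [hk, if_false])
      rwa [Finset.sum_congr rfl (fun k hk => if_pos hk)] at this
    have h1 := ((hr m).sub hfin).mul_left ((-1) ^ n)
    have h2 : ∑ k ∈ Finset.range (m + 1), c k * rfac δ m n (lam δ k) =
        ∑ k ∈ Finset.Icc 1 m, c k * rfac δ m n (lam δ k) + c 0 := by
      rw [Finset.sum_range_succ', sum_Icc_one]
      simp [rfac, lam]
    rw [hsum2, h2] at h1
    rw [show (-1 : ℝ) ^ n * ((A 0 - c 0) - S m) = (-1) ^ n * (A 0 - ∑ i ∈ Finset.Icc 1 n,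
      (-1) ^ (i - 1) * bco δ m n i * A i -
      (∑ k ∈ Finset.Icc 1 m, c k * rfac δ m n (lam δ k) + c 0)) by rw [hS]; ring]
    refine Eq.mp (congrArg (fun F => HasSum F _) (funext fun k => Eq.symm ?_)) h1
    · skip
      by_cases hk : k ∈ Finset.range (m + 1)
      · rw [if_pos hk, sub_self, mul_zero, rho_of_le hδ hn, mul_zero]
        have := Finset.mem_range.1 hk; omega
      · rw [if_neg hk, rho_of_lt hδ hn (by simpa using hk)]
        have : ((-1 : ℝ) ^ n) * (-1) ^ n = 1 := by rw [← mul_pow]; simp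
        linear_combination (-(c k * rho δ m n (lam δ k))) * this
  have hanti : ∀ {m m'}, m ≤ m' →
      (-1 : ℝ) ^ n * ((A 0 - c 0) - S m') ≤ (-1) ^ n * ((A 0 - c 0) - S m) := by
    intro m m' h
    exact hasSum_le (fun k => mul_le_mul_of_nonneg_left (rho_anti hδ h n k) (hc k)) (hρ m') (hρ m)
  refine ⟨fun he m m' h => ?_, fun ho m m' h => ?_, ?_⟩
  · have := hanti h
    rw [he.neg_one_pow] at this; linarith
  · have := hanti h
    rw [ho.neg_one_pow] at this; linarith
  · have ht : Tendsto (fun m => ∑' k, c k * rho δ m n (lam δ k)) atTop (nhds (∑' _ : ℕ, (0 : ℝ))) := by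
      apply tendsto_tsum_of_dominated_convergence (hρ 0).summable
      · intro k
        apply tendsto_const_nhds.congr'
        filter_upwards [eventually_ge_atTop k] with m hm
        rw [rho_of_le hδ hn (by omega), mul_zero]
      · refine Eventually.of_forall fun m k => ?_
        rw [Real.norm_eq_abs, abs_of_nonneg (mul_nonneg (hc k) (rho_nonneg _ _ _ _))]
        exact mul_le_mul_of_nonneg_left (rho_anti hδ (Nat.zero_le m) n k) (hc k)
    have he : ∀ m, S m = (A 0 - c 0) - (-1) ^ n * ∑' k, c k * rho δ m n (lam δ k) := by
      intro m
      rw [(hρ m).tsum_eq]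
      have : ((-1 : ℝ) ^ n) * (-1) ^ n = 1 := by rw [← mul_pow]; simp
      linear_combination (A 0 - c 0 - S m) * this
    rw [tsum_zero] at ht
    have := (tendsto_const_nhds (x := A 0 - c 0)).sub (ht.const_mul ((-1) ^ n))
    rw [mul_zero, sub_zero] at this
    exact this.congr (fun m => (he m).symm)

theorem erealIoo_isOpen (α ω : EReal) : IsOpen (erealIoo α ω) := by
  have : erealIoo α ω = (fun x : ℝ => (x : EReal)) ⁻¹' Set.Ioo α ω := rfl
  rw [this]
  exact isOpen_Ioo.preimage continuous_coe_real_ereal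

theorem erealIoo_ordConnected (α ω : EReal) : (erealIoo α ω).OrdConnected := by
  constructor
  rintro a ⟨ha1, ha2⟩ b ⟨hb1, hb2⟩ x ⟨hx1, hx2⟩
  exact ⟨lt_of_lt_of_le ha1 (EReal.coe_le_coe_iff.2 hx1), lt_of_le_of_lt (EReal.coe_le_coe_iff.2 hx2) hb2⟩

theorem erealIoo_frontier (α ω : EReal) : (closure (erealIoo α ω) \ erealIoo α ω).Countable := by
  have hcl : closure (erealIoo α ω) ⊆ (fun x : ℝ => (x : EReal)) ⁻¹' Set.Icc α ω := by
    apply closure_minimal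
    · rintro x ⟨h1, h2⟩; exact ⟨h1.le, h2.le⟩
    · exact isClosed_Icc.preimage continuous_coe_real_ereal
  have : closure (erealIoo α ω) \ erealIoo α ω ⊆ {α.toReal, ω.toReal} := by
    rintro x ⟨hx, hx'⟩
    obtain ⟨h1, h2⟩ := hcl hx
    simp only at h1 h2
    by_cases h3 : α = (x : EReal)
    · left; simp [h3]
    by_cases h4 : ω = (x : EReal)
    · right; simp [h4]
    exact absurd ⟨lt_of_le_of_ne h1 h3, lt_of_le_of_ne h2 (fun h => h4 h.symm)⟩ hx'
  exact (Set.toFinite _).countable.mono this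

theorem pq_zeros_finite {δ β γ : ℝ} (h : 0 < |δ| + |β| + |γ|) : {x | pq δ β γ x = 0}.Finite := by
  set p : Polynomial ℝ := Polynomial.C δ * Polynomial.X ^ 2 + Polynomial.C β * Polynomial.X + Polynomial.C γ with hp
  have hp0 : p ≠ 0 := by
    intro h0
    have h2 : p.coeff 2 = δ := by simp [hp, Polynomial.coeff_X, Polynomial.coeff_C]
    have h1 : p.coeff 1 = β := by simp [hp, Polynomial.coeff_X, Polynomial.coeff_C]
    have h00 : p.coeff 0 = γ := by simp [hp]
    rw [h0] at h2 h1 h00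
    simp at h2 h1 h00
    rw [← h2, ← h1, ← h00] at h
    simp at h
  refine (p.rootSet_finite ℝ).subset ?_
  intro x hx
  rw [Polynomial.mem_rootSet]
  refine ⟨hp0, ?_⟩
  simp only [Set.mem_ofPred_eq, pq] at hx
  simp [hp, hx]

/-- An integrated Pearson density is a.e. measurable, and hence `(μ-t) f` integrable. -/
theorem pearson_basic {P : Measure ℝ} {f : ℝ → ℝ} {μ δ β γ : ℝ} {J : Set ℝ}
    (hIP : IsIntegratedPearson P f μ δ β γ) (hsupp : {x : ℝ | 0 < f x} = J) (hJ : IsOpen J) :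
    AEMeasurable f volume := by
  obtain ⟨hP, f0, hPd, hid, hμ, hq, hG⟩ := hIP
  have hIntg : ∀ b ∈ J, IntegrableOn (fun t => (μ - t) * f t) (Set.Iic b) := by
    intro b hb
    obtain ⟨ε, hε, hball⟩ := Metric.isOpen_iff.1 hJ b hb
    have hinf : (Set.Ioo b (b + ε) \ {x | pq δ β γ x = 0}).Nonempty :=
      ((Set.Ioo_infinite (by linarith)).sdiff (pq_zeros_finite hq)).nonempty
    obtain ⟨c, ⟨hc1, hc2⟩, hc3⟩ := hinf
    have hcJ : c ∈ J := hball (by rw [Metric.mem_ball, Real.dist_eq, abs_lt]; constructor <;> linarith)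
    rw [← hsupp] at hcJ
    have hne : (∫ t in Set.Iic c, (μ - t) * f t) ≠ 0 := by
      rw [hG c]; exact mul_ne_zero hc3 (ne_of_gt hcJ)
    have : IntegrableOn (fun t => (μ - t) * f t) (Set.Iic c) := by
      by_contra hcon; exact hne (integral_undef hcon)
    exact this.mono_set (Set.Iic_subset_Iic.2 hc1.le)
  have hm : ∀ b ∈ J, AEMeasurable f (volume.restrict (Set.Iic b)) := by
    intro b hb
    have h1 := (hIntg b hb).aestronglyMeasurable.aemeasurable
    have h2 : AEMeasurable (fun t => ((μ - t) * f t) / (μ - t)) (volume.restrict (Set.Iic b)) :=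
      h1.div (by fun_prop)
    refine h2.congr ?_
    have : ∀ᵐ t ∂(volume.restrict (Set.Iic b)), t ≠ μ :=
      ae_restrict_of_ae (by simp [ae_iff])
    filter_upwards [this] with t ht
    have : μ - t ≠ 0 := fun h => ht (by linarith)
    field_simp
  have hU : AEMeasurable f (volume.restrict (⋃ r : {r : ℚ // (r : ℝ) ∈ J}, Set.Iic ((r : ℚ) : ℝ))) := by
    rw [aemeasurable_iUnion_iff]
    intro r; exact hm _ r.2
  have hsub : J ⊆ ⋃ r : {r : ℚ // (r : ℝ) ∈ J}, Set.Iic ((r : ℚ) : ℝ) := by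
    intro b hb
    obtain ⟨ε, hε, hball⟩ := Metric.isOpen_iff.1 hJ b hb
    obtain ⟨r, hr1, hr2⟩ := exists_rat_btwn (show b < b + ε by linarith)
    have : (r : ℝ) ∈ J := hball (by rw [Metric.mem_ball, Real.dist_eq, abs_lt]; constructor <;> linarith)
    exact Set.mem_iUnion.2 ⟨⟨r, this⟩, hr1.le⟩
  have hJm : AEMeasurable f (volume.restrict J) := hU.mono_measure (Measure.restrict_mono hsub le_rfl)
  have := (aemeasurable_indicator_iff hJ.measurableSet).2 hJm
  refine this.congr (Eventually.of_forall fun x => ?_)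
  by_cases hx : x ∈ J
  · simp [hx]
  · simp only [Set.indicator_of_notMem hx]
    rw [← hsupp] at hx
    exact (le_antisymm (not_lt.1 hx) (f0 x)).symm

structure PData (P : Measure ℝ) (f : ℝ → ℝ) (μ δ β γ : ℝ) (J : Set ℝ) : Prop where
  hδ : δ ≤ 0
  prob : IsProbabilityMeasure P
  opn : IsOpen J
  conn : J.OrdConnected
  ne : J.Nonempty
  fpos : ∀ x ∈ J, 0 < f x
  foff : ∀ x, x ∉ J → f x = 0
  fmeas : Measurable f
  fcont : ContinuousOn f J
  qpos : ∀ x ∈ J, 0 < pq δ β γ x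
  ucont : Continuous (fun x => pq δ β γ x * f x)
  uder : ∃ s : Set ℝ, s.Countable ∧ (∀ x ∈ J, x ∉ s) ∧ ∀ x, x ∉ s → HasDerivAt (fun x => pq δ β γ x * f x) ((μ - x) * f x) x
  intP : ∀ φ : ℝ → ℝ, Integrable φ P ↔ Integrable (fun x => φ x * f x) volume
  integP : ∀ φ : ℝ → ℝ, ∫ x, φ x ∂P = ∫ x, φ x * f x
  memJ : ∀ᵐ x ∂P, x ∈ J
  ubdd : ∃ K, ∀ x, pq δ β γ x * f x ≤ K

theorem pdata_of {P : Measure ℝ} {f : ℝ → ℝ} {μ δ β γ : ℝ} {J : Set ℝ} (hδ : δ ≤ 0)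
    (hIP : IsIntegratedPearson P f μ δ β γ) (hsupp : {x : ℝ | 0 < f x} = J) (hJ : IsOpen J)
    (hconn : J.OrdConnected) (hfr : (closure J \ J).Countable) :
    PData P f μ δ β γ J := by
  have hfm := pearson_basic hIP hsupp hJ
  obtain ⟨hP, f0, hPd, hid, hμ, hq, hG⟩ := hIP
  have foff : ∀ x, x ∉ J → f x = 0 := by
    intro x hx; rw [← hsupp] at hx
    exact le_antisymm (not_lt.1 hx) (f0 x)
  have fpos : ∀ x ∈ J, 0 < f x := by intro x hx; rw [← hsupp] at hx; exact hx
  have hfm' : AEMeasurable (fun x => ENNReal.ofReal (f x)) volume := hfm.ennreal_ofReal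
  have intP : ∀ φ : ℝ → ℝ, Integrable φ P ↔ Integrable (fun x => φ x * f x) volume := by
    intro φ
    rw [hPd, integrable_withDensity_iff_integrable_smul₀' hfm' (by simp)]
    simp [ENNReal.toReal_ofReal (f0 _), mul_comm]
  have integP : ∀ φ : ℝ → ℝ, ∫ x, φ x ∂P = ∫ x, φ x * f x := by
    intro φ
    rw [hPd, integral_withDensity_eq_integral_toReal_smul₀ hfm' (by simp)]
    simp [ENNReal.toReal_ofReal (f0 _), mul_comm]
  have hmul : ∀ᵐ x ∂P, x ∈ J := by
    rw [hPd, ae_withDensity_iff' hfm']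
    refine Eventually.of_forall fun x hx => ?_
    by_contra h
    exact hx (by simp [foff x h])
  have hne : J.Nonempty := by
    obtain ⟨x, hx⟩ := hmul.exists
    exact ⟨x, hx⟩
  set h : ℝ → ℝ := fun t => (μ - t) * f t with hh
  have hfi : Integrable f volume := by
    have := (intP (fun _ => 1)).1 (integrable_const _)
    simpa using this
  have hhi : Integrable h volume := (intP (fun x => μ - x)).1 ((integrable_const _).sub hid)
  have hh0 : ∫ t, h t = 0 := by
    have := integP (fun x => μ - x)
    rw [integral_sub (integrable_const _) hid] at this
    rw [← this, ← hμ]; simp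
  set U : ℝ → ℝ := fun x => pq δ β γ x * f x with hU
  have hUG : ∀ x, U x = ∫ t in Set.Iic x, h t := fun x => (hG x).symm
  have hUd : ∀ a x, U x = U a + ∫ t in a..x, h t := by
    intro a x
    rw [hUG, hUG, ← intervalIntegral.integral_Iic_sub_Iic hhi.integrableOn hhi.integrableOn]; ring
  have hUc : Continuous U := by
    have : U = fun x => U 0 + ∫ t in (0:ℝ)..x, h t := by ext x; exact hUd 0 x
    rw [this]
    exact continuous_const.add (intervalIntegral.continuous_primitive (fun a b => hhi.intervalIntegrable) 0)
  have hnear : ∀ x ∈ J, ∃ ε > 0, Set.Ioo (x - ε) (x + ε) ⊆ J := by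
    intro x hx
    obtain ⟨ε, hε, hball⟩ := Metric.isOpen_iff.1 hJ x hx
    rw [Real.ball_eq_Ioo] at hball
    exact ⟨ε, hε, hball⟩
  have hUpos : ∀ x ∈ J, 0 < U x := by
    intro x hx
    obtain ⟨ε, hε, hI⟩ := hnear x hx
    rcases le_or_gt x μ with hxμ | hxμ
    · rw [hUG, setIntegral_pos_iff_support_of_nonneg_ae _ hhi.integrableOn]
      · refine lt_of_lt_of_le ?_ (measure_mono (show Set.Ioo (x - ε) x ⊆ _ from ?_))
        · simp [hε]
        · intro t ht
          refine ⟨?_, ht.2.le⟩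
          have := fpos t (hI ⟨ht.1, by linarith [ht.2]⟩)
          have h2 : 0 < μ - t := by linarith [ht.2]
          exact ne_of_gt (mul_pos h2 this)
      · rw [EventuallyLE, ae_restrict_iff' measurableSet_Iic]
        refine Eventually.of_forall fun t ht => ?_
        have : t ≤ x := ht
        exact mul_nonneg (by linarith) (f0 t)
    · have e1 : U x = ∫ t in Set.Ioi x, -h t := by
        have := integral_add_compl (measurableSet_Iic (a := x)) hhi
        rw [hh0, Set.compl_Iic, ← hUG] at this
        rw [integral_neg]; linarith
      have hneg : Integrable (fun t => -h t) volume := hhi.neg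
      rw [e1, setIntegral_pos_iff_support_of_nonneg_ae _ hneg.integrableOn]
      · refine lt_of_lt_of_le ?_ (measure_mono (show Set.Ioo x (x + ε) ⊆ _ from ?_))
        · simp [hε]
        · intro t ht
          refine ⟨?_, ht.1⟩
          have := fpos t (hI ⟨by linarith [ht.1], ht.2⟩)
          have h2 : 0 < t - μ := by linarith [ht.1]
          have := mul_pos h2 this
          refine ne_of_gt ?_
          simp only [hh]; linarith
      · rw [EventuallyLE, ae_restrict_iff' measurableSet_Ioi]
        refine Eventually.of_forall fun t ht => ?_
        have : x < t := ht
        have := mul_nonneg (show 0 ≤ t - μ by linarith) (f0 t)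
        simp only [hh, Pi.zero_apply]; linarith
  have qpos : ∀ x ∈ J, 0 < pq δ β γ x := by
    intro x hx
    exact pos_of_mul_pos_left (hUpos x hx) (f0 x)
  have hqc : Continuous (pq δ β γ) := by unfold pq; fun_prop
  have fcont : ContinuousOn f J := by
    have : ContinuousOn (fun x => U x / pq δ β γ x) J :=
      hUc.continuousOn.div hqc.continuousOn (fun x hx => (qpos x hx).ne')
    refine this.congr fun x hx => ?_
    have := (qpos x hx).ne'
    simp only [hU]; field_simp
  have fmeas : Measurable f := by
    classical
    have h1 : Measurable (J.piecewise f (fun _ => 0)) :=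
      fcont.measurable_piecewise continuous_const.continuousOn hJ.measurableSet
    have : J.piecewise f (fun _ => 0) = f := by
      ext x
      by_cases hx : x ∈ J
      · simp [hx]
      · simp [hx, foff x hx]
    rwa [this] at h1
  refine ⟨hδ, hP, hJ, hconn, hne, fpos, foff, fmeas, fcont, qpos, hUc, ⟨closure J \ J, hfr, ?_, ?_⟩, intP, integP, hmul, ?_⟩
  · intro x hx h; exact h.2 hx
  · intro x hx
    by_cases hxJ : x ∈ J
    · have hca : ContinuousAt h x := by
        have : ContinuousAt f x := fcont.continuousAt (hJ.mem_nhds hxJ)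
        exact (by fun_prop : ContinuousAt (fun t => (μ - t)) x).mul this
      have := intervalIntegral.integral_hasDerivAt_right (a := x) (b := x) hhi.intervalIntegrable
        (hhi.aestronglyMeasurable.stronglyMeasurableAtFilter) hca
      have h2 := this.const_add (U x)
      refine h2.congr_of_eventuallyEq ?_
      exact Eventually.of_forall fun y => hUd x y
    · have hxc : x ∉ closure J := fun h => hx ⟨h, hxJ⟩
      have hev : ∀ᶠ y in nhds x, U y = 0 := by
        filter_upwards [isClosed_closure.isOpen_compl.mem_nhds hxc] with y hy
        simp [hU, foff y (fun h => hy (subset_closure h))]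
      simp only [foff x hxJ, mul_zero]
      exact (hasDerivAt_const x (0:ℝ)).congr_of_eventuallyEq hev
  · refine ⟨∫ t, ‖h t‖, fun x => ?_⟩
    rw [show pq δ β γ x * f x = U x from rfl, hUG]
    refine (Real.le_norm_self _).trans ((norm_integral_le_integral_norm _).trans ?_)
    exact setIntegral_le_integral hhi.norm (Eventually.of_forall fun _ => norm_nonneg _)

section
variable {P : Measure ℝ} {f : ℝ → ℝ} {μ δ β γ : ℝ} {J : Set ℝ}

theorem integrable_exp_neg_abs {c : ℝ} (hc : 0 < c) :
    Integrable (fun x : ℝ => Real.exp (-c * |x|)) volume := by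
  rw [← integrableOn_univ, ← Set.Iic_union_Ioi (a := (0:ℝ)), integrableOn_union]
  constructor
  · refine (integrableOn_exp_mul_Iic hc 0).congr_fun ?_ measurableSet_Iic
    intro x hx
    have : x ≤ 0 := hx
    simp only [abs_of_nonpos this]; congr 1; ring
  · refine (integrableOn_exp_mul_Ioi (a := -c) (by linarith) 0).congr_fun ?_ measurableSet_Ioi
    intro x hx
    have : (0:ℝ) < x := hx
    simp only [abs_of_pos this]

theorem pq_le {δ β γ : ℝ} (hδ : δ ≤ 0) (x : ℝ) : pq δ β γ x ≤ |β| * |x| + |γ| := by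
  unfold pq
  have h1 : δ * x ^ 2 ≤ 0 := mul_nonpos_of_nonpos_of_nonneg hδ (sq_nonneg x)
  have h2 : β * x ≤ |β| * |x| := by rw [← abs_mul]; exact le_abs_self _
  linarith [le_abs_self γ]

theorem pq_cont (δ β γ : ℝ) : Continuous (pq δ β γ) := by unfold pq; fun_prop


theorem PData.f0 (D : PData P f μ δ β γ J) (x : ℝ) : 0 ≤ f x := by
  by_cases hx : x ∈ J
  · exact (D.fpos x hx).le
  · rw [D.foff x hx]

theorem PData.u0 (D : PData P f μ δ β γ J) (x : ℝ) : 0 ≤ pq δ β γ x * f x := by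
  by_cases hx : x ∈ J
  · exact (mul_pos (D.qpos x hx) (D.fpos x hx)).le
  · rw [D.foff x hx, mul_zero]

theorem PData.uderJ (D : PData P f μ δ β γ J) (x : ℝ) (hx : x ∈ J) :
    HasDerivAt (fun x => pq δ β γ x * f x) ((μ - x) * f x) x := by
  obtain ⟨s, _, h1, h2⟩ := D.uder
  exact h2 x (h1 x hx)

theorem PData.udecay (D : PData P f μ δ β γ J) :
    ∃ c > 0, ∃ K, 0 ≤ K ∧ ∀ x, pq δ β γ x * f x ≤ K * Real.exp (-c * |x|) := by
  obtain ⟨Ku, hKu⟩ := D.ubdd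
  obtain ⟨x0, hx0⟩ := D.ne
  have hKu0 : 0 ≤ Ku := (D.u0 x0).trans (hKu x0)
  set B := |β| + |γ| with hB
  have hB0 : 0 ≤ B := by positivity
  set c := 1 / (2 * (B + 1)) with hc
  have hc0 : 0 < c := by positivity
  have hcB : c * B ≤ 1 / 2 := by
    rw [hc, div_mul_eq_mul_div, div_le_div_iff₀ (by positivity) (by norm_num)]; linarith
  set R := max (2 * |μ| + 1) |x0| with hR
  have hR1 : 2 * |μ| + 1 ≤ R := le_max_left _ _
  have hR2 : |x0| ≤ R := le_max_right _ _
  have hμ0 := abs_nonneg μ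
  have hq : ∀ x, R ≤ |x| → c * pq δ β γ x ≤ |x| / 2 := by
    intro x hx
    have h1 := pq_le (β := β) (γ := γ) D.hδ x
    have h2 : |β| * |x| + |γ| ≤ B * |x| := by
      rw [hB, add_mul]; nlinarith [abs_nonneg γ]
    calc c * pq δ β γ x ≤ c * (B * |x|) := by gcongr; linarith
      _ = (c * B) * |x| := by ring
      _ ≤ (1/2) * |x| := by gcongr
      _ = _ := by ring
  refine ⟨c, hc0, Ku * Real.exp (c * R), by positivity, fun x => ?_⟩
  by_cases hxJ : x ∉ J
  · rw [D.foff x hxJ, mul_zero]; positivity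
  push Not at hxJ
  rw [mul_assoc, ← Real.exp_add]
  rcases le_or_gt |x| R with hxR | hxR
  · refine (hKu x).trans (le_mul_of_one_le_right hKu0 ?_)
    rw [← Real.exp_zero]
    apply Real.exp_le_exp.2
    nlinarith
  rcases le_total 0 x with hx | hx
  · rw [abs_of_nonneg hx] at *
    have hsub : Set.Icc R x ⊆ J := fun y hy => D.conn.out hx0 hxJ ⟨by linarith [le_abs_self x0, hy.1], hy.2⟩
    have hanti : AntitoneOn (fun y => Real.exp (c * y) * (pq δ β γ y * f y)) (Set.Icc R x) := by
      refine antitoneOn_of_hasDerivWithinAt_nonpos (f' := fun y => Real.exp (c * y) * c * (pq δ β γ y * f y) + Real.exp (c * y) * ((μ - y) * f y)) (convex_Icc _ _) ?_ ?_ ?_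
      · exact ((by fun_prop : Continuous fun y : ℝ => Real.exp (c * y)).mul D.ucont).continuousOn
      · intro y hy
        have hyJ := hsub (interior_subset hy)
        have h1 : HasDerivAt (fun y : ℝ => Real.exp (c * y)) (Real.exp (c * y) * c) y := by
          have := ((hasDerivAt_id y).const_mul c).exp
          simpa using this
        exact (h1.mul (D.uderJ y hyJ)).hasDerivWithinAt
      · intro y hy
        have hy' := interior_subset hy
        have hyJ := hsub hy'
        have hyR : R ≤ y := hy'.1
        have h1 := hq y (hyR.trans (le_abs_self y))
        rw [abs_of_nonneg (by linarith : (0:ℝ) ≤ y)] at h1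
        have h2 : c * pq δ β γ y + (μ - y) ≤ 0 := by linarith [le_abs_self μ]
        have h3 : 0 ≤ Real.exp (c * y) * f y := mul_nonneg (Real.exp_pos _).le (D.f0 y)
        have := mul_nonpos_of_nonneg_of_nonpos h3 h2
        nlinarith
    have := hanti ⟨le_rfl, hxR.le⟩ ⟨hxR.le, le_rfl⟩ hxR.le
    simp only at this
    have h4 : Real.exp (c * x) * (pq δ β γ x * f x) ≤ Real.exp (c * R) * Ku :=
      this.trans (mul_le_mul_of_nonneg_left (hKu R) (Real.exp_pos _).le)
    rw [Real.exp_add]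
    have h5 : Real.exp (c * x) * Real.exp (-c * x) = 1 := by rw [← Real.exp_add]; simp
    have h6 := mul_le_mul_of_nonneg_right h4 (Real.exp_pos (-c * x)).le
    calc pq δ β γ x * f x = (Real.exp (c * x) * Real.exp (-c * x)) * (pq δ β γ x * f x) := by rw [h5, one_mul]
      _ = Real.exp (c * x) * (pq δ β γ x * f x) * Real.exp (-c * x) := by ring
      _ ≤ _ := h6
      _ = _ := by ring
  · rw [abs_of_nonpos hx] at *
    have hsub : Set.Icc x (-R) ⊆ J := fun y hy => D.conn.out hxJ hx0 ⟨hy.1, by linarith [neg_abs_le x0, hy.2]⟩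
    have hanti : MonotoneOn (fun y => Real.exp (-c * y) * (pq δ β γ y * f y)) (Set.Icc x (-R)) := by
      refine monotoneOn_of_hasDerivWithinAt_nonneg (f' := fun y => Real.exp (-c * y) * (-c) * (pq δ β γ y * f y) + Real.exp (-c * y) * ((μ - y) * f y)) (convex_Icc _ _) ?_ ?_ ?_
      · exact ((by fun_prop : Continuous fun y : ℝ => Real.exp (-c * y)).mul D.ucont).continuousOn
      · intro y hy
        have hyJ := hsub (interior_subset hy)
        have h1 : HasDerivAt (fun y : ℝ => Real.exp (-c * y)) (Real.exp (-c * y) * (-c)) y := by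
          have := ((hasDerivAt_id y).const_mul (-c)).exp
          simpa using this
        exact (h1.mul (D.uderJ y hyJ)).hasDerivWithinAt
      · intro y hy
        have hy' := interior_subset hy
        have hyJ := hsub hy'
        have hyR : y ≤ -R := hy'.2
        have h1 := hq y (by rw [abs_of_nonpos (by linarith)]; linarith)
        rw [abs_of_nonpos (by linarith : y ≤ 0)] at h1
        have h2 : 0 ≤ -(c * pq δ β γ y) + (μ - y) := by linarith [neg_abs_le μ]
        have h3 : 0 ≤ Real.exp (-c * y) * f y := mul_nonneg (Real.exp_pos _).le (D.f0 y)
        have := mul_nonneg h3 h2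
        nlinarith
    have hxR' : x ≤ -R := by linarith
    have := hanti ⟨le_rfl, hxR'⟩ ⟨hxR', le_rfl⟩ hxR'
    simp only at this
    have h4 : Real.exp (-c * x) * (pq δ β γ x * f x) ≤ Real.exp (-c * -R) * Ku :=
      this.trans (mul_le_mul_of_nonneg_left (hKu _) (Real.exp_pos _).le)
    rw [Real.exp_add]
    have h5 : Real.exp (-c * x) * Real.exp (-c * -x) = 1 := by rw [← Real.exp_add]; simp
    have h6 := mul_le_mul_of_nonneg_right h4 (Real.exp_pos (-c * -x)).le
    calc pq δ β γ x * f x = (Real.exp (-c * x) * Real.exp (-c * -x)) * (pq δ β γ x * f x) := by rw [h5, one_mul]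
      _ = Real.exp (-c * x) * (pq δ β γ x * f x) * Real.exp (-c * -x) := by ring
      _ ≤ _ := h6
      _ = _ := by rw [show -c * -R = c * R by ring]; ring

theorem PData.qlow (D : PData P f μ δ β γ J) :
    ∃ R ε, 0 < ε ∧ ∀ x ∈ J, R ≤ |x| → ε ≤ pq δ β γ x := by
  obtain ⟨x0, hx0⟩ := D.ne
  rcases lt_or_eq_of_le D.hδ with h | h
  · refine ⟨max 1 ((|β| + |γ| + 1) / (-δ)), 1, one_pos, fun x hx hR => ?_⟩
    exfalso
    have h1 : 1 ≤ |x| := (le_max_left _ _).trans hR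
    have h2 : (|β| + |γ| + 1) / (-δ) ≤ |x| := (le_max_right _ _).trans hR
    rw [div_le_iff₀ (by linarith)] at h2
    have h3 := D.qpos x hx
    unfold pq at h3
    have h4 : β * x ≤ |β| * |x| := by rw [← abs_mul]; exact le_abs_self _
    have h5 : |γ| ≤ |γ| * |x| := le_mul_of_one_le_right (abs_nonneg γ) h1
    have h6 : δ * x ^ 2 = -(|x| * -δ) * |x| := by rw [← sq_abs]; ring
    nlinarith [le_abs_self γ, abs_nonneg β, abs_nonneg γ]
  · by_cases hβ : β = 0
    · refine ⟨0, γ, ?_, fun x hx _ => ?_⟩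
      · have := D.qpos x0 hx0; unfold pq at this; simpa [h, hβ] using this
      · unfold pq; simp [h, hβ]
    · refine ⟨(|γ| + 1) / |β|, 1, one_pos, fun x hx hR => ?_⟩
      rw [div_le_iff₀ (abs_pos.2 hβ)] at hR
      have h3 := D.qpos x hx
      unfold pq at *
      rw [h] at *
      have h4 : |x| * |β| = |β * x| := by rw [abs_mul, mul_comm]
      rw [h4] at hR
      rcases le_total 0 (β * x) with h5 | h5
      · rw [abs_of_nonneg h5] at hR; linarith [neg_abs_le γ]
      · rw [abs_of_nonpos h5] at hR; linarith [le_abs_self γ]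

theorem PData.expo (D : PData P f μ δ β γ J) :
    ∃ t > 0, Integrable (fun x => Real.exp (t * |x|)) P ∧
      ∃ K, 0 ≤ K ∧ ∀ x, pq δ β γ x * f x ≤ K * Real.exp (-t * |x|) := by
  obtain ⟨c, hc, K, hK0, hK⟩ := D.udecay
  obtain ⟨R, ε, hε, hq⟩ := D.qlow
  have := D.prob
  have hfi : Integrable f volume := by
    simpa using (D.intP (fun _ => 1)).1 (integrable_const _)
  refine ⟨c / 2, by positivity, ?_, K, hK0, fun x => (hK x).trans ?_⟩
  · rw [D.intP]
    have hdom : Integrable (fun x => Real.exp (c / 2 * R) * f x + ε⁻¹ * K * Real.exp (-(c / 2) * |x|)) volume :=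
      (hfi.const_mul _).add ((integrable_exp_neg_abs (by positivity)).const_mul _)
    refine hdom.mono' ((Continuous.measurable (by fun_prop)).mul D.fmeas).aestronglyMeasurable ?_
    refine Eventually.of_forall fun x => ?_
    have h0 := D.f0 x
    rw [Real.norm_of_nonneg (by positivity)]
    have h1 : 0 ≤ Real.exp (c / 2 * R) * f x := by positivity
    have h2 : 0 ≤ ε⁻¹ * K * Real.exp (-(c / 2) * |x|) := by positivity
    by_cases hx : x ∈ J
    · rcases le_total R |x| with hR | hR
      · have h3 : f x ≤ ε⁻¹ * (pq δ β γ x * f x) := by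
          rw [← mul_assoc]
          refine le_mul_of_one_le_left h0 ?_
          rw [inv_mul_eq_div, le_div_iff₀ hε, one_mul]; exact hq x hx hR
        have h4 : Real.exp (c / 2 * |x|) * Real.exp (-c * |x|) = Real.exp (-(c / 2) * |x|) := by
          rw [← Real.exp_add]; congr 1; ring
        calc Real.exp (c / 2 * |x|) * f x ≤ Real.exp (c / 2 * |x|) * (ε⁻¹ * (K * Real.exp (-c * |x|))) := by
              gcongr; exact h3.trans (mul_le_mul_of_nonneg_left (hK x) (by positivity))
          _ = ε⁻¹ * K * (Real.exp (c / 2 * |x|) * Real.exp (-c * |x|)) := by ring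
          _ = ε⁻¹ * K * Real.exp (-(c / 2) * |x|) := by rw [h4]
          _ ≤ _ := by linarith
      · have : Real.exp (c / 2 * |x|) * f x ≤ Real.exp (c / 2 * R) * f x := by gcongr
        linarith
    · rw [D.foff x hx]; simp; positivity
  · gcongr; nlinarith [abs_nonneg x]

end

section
variable {P : Measure ℝ} {f : ℝ → ℝ} {μ δ β γ : ℝ} {J : Set ℝ}

theorem poly_exp_bound (p : Polynomial ℝ) {s : ℝ} (hs : 0 < s) :
    ∃ C, 0 ≤ C ∧ ∀ x, |p.eval x| ≤ C * Real.exp (s * |x|) := by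
  induction p using Polynomial.induction_on' with
  | add p r hp hr =>
    obtain ⟨C, hC0, hC⟩ := hp
    obtain ⟨C', hC0', hC'⟩ := hr
    refine ⟨C + C', by positivity, fun x => ?_⟩
    rw [Polynomial.eval_add, add_mul]
    exact (abs_add_le _ _).trans (add_le_add (hC x) (hC' x))
  | monomial k a =>
    refine ⟨|a| * ((k.factorial : ℝ) / s ^ k), by positivity, fun x => ?_⟩
    rw [Polynomial.eval_monomial, abs_mul, abs_pow, mul_assoc]
    gcongr
    have h := Real.pow_div_factorial_le_exp (s * |x|) (by positivity) k
    rw [div_le_iff₀ (by positivity), mul_pow] at h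
    rw [div_mul_eq_mul_div, le_div_iff₀ (by positivity)]
    linarith

theorem PData.polyExpInt (D : PData P f μ δ β γ J) :
    ∃ t > 0, ∀ p : Polynomial ℝ, Integrable (fun x => Real.exp (t * |x|) * p.eval x) P := by
  obtain ⟨t, ht, hi, _⟩ := D.expo
  refine ⟨t / 2, by positivity, fun p => ?_⟩
  obtain ⟨C, hC0, hC⟩ := poly_exp_bound p (half_pos ht)
  refine (hi.const_mul C).mono' (Continuous.aestronglyMeasurable (by fun_prop)) (Eventually.of_forall fun x => ?_)
  rw [norm_mul, Real.norm_of_nonneg (Real.exp_pos _).le, Real.norm_eq_abs]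
  calc _ ≤ Real.exp (t / 2 * |x|) * (C * Real.exp (t / 2 * |x|)) := by gcongr; exact hC x
    _ = C * (Real.exp (t / 2 * |x|) * Real.exp (t / 2 * |x|)) := by ring
    _ = _ := by rw [← Real.exp_add]; congr 2; ring

theorem PData.polyInt (D : PData P f μ δ β γ J) (p : Polynomial ℝ) :
    Integrable (fun x => p.eval x) P := by
  obtain ⟨t, ht, hi⟩ := D.polyExpInt
  refine (hi p).mono (Continuous.aestronglyMeasurable (by fun_prop)) (Eventually.of_forall fun x => ?_)
  rw [norm_mul, Real.norm_of_nonneg (Real.exp_pos _).le]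
  refine le_mul_of_one_le_left (norm_nonneg _) ?_
  rw [← Real.exp_zero]; apply Real.exp_le_exp.2; positivity

open Polynomial in
def qpoly (δ β γ : ℝ) : Polynomial ℝ := C δ * X ^ 2 + C β * X + C γ

theorem qpoly_eval (δ β γ x : ℝ) : (qpoly δ β γ).eval x = pq δ β γ x := by
  simp [qpoly, pq]

open Polynomial in
def tpoly (μ δ β : ℝ) (i : ℕ) : Polynomial ℝ := C μ - X + C (i : ℝ) * (C (2 * δ) * X + C β)

theorem tpoly_eval (μ δ β : ℝ) (i : ℕ) (x : ℝ) :
    (tpoly μ δ β i).eval x = μ - x + i * (2 * δ * x + β) := by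
  simp [tpoly]

/-- zero of `τ_i` -/
def tzero (μ δ β : ℝ) (i : ℕ) : ℝ := (μ + i * β) / (1 - 2 * i * δ)

theorem kap_pos (hδ : δ ≤ 0) (i : ℕ) : 0 < 1 - 2 * i * δ := by
  have : (0:ℝ) ≤ i := Nat.cast_nonneg i
  nlinarith

theorem tpoly_eval' (hδ : δ ≤ 0) (i : ℕ) (x : ℝ) :
    (tpoly μ δ β i).eval x = (1 - 2 * i * δ) * (tzero μ δ β i - x) := by
  rw [tpoly_eval, tzero]
  have := (kap_pos hδ i).ne'
  rw [mul_sub, mul_div_cancel₀ _ this]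
  ring

theorem PData.Fder (_D : PData P f μ δ β γ J) (i : ℕ) {x : ℝ}
    (hx : HasDerivAt (fun x => pq δ β γ x * f x) ((μ - x) * f x) x) :
    HasDerivAt (fun x => pq δ β γ x ^ i * (pq δ β γ x * f x))
      ((tpoly μ δ β i).eval x * (pq δ β γ x ^ i * f x)) x := by
  have hq : HasDerivAt (pq δ β γ) (2 * δ * x + β) x := by
    have := (((hasDerivAt_id x).pow 2).const_mul δ).add ((hasDerivAt_id x).const_mul β) |>.add_const γ
    refine this.congr_deriv ?_
    simp; ring
  refine ((hq.pow i).mul hx).congr_deriv ?_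
  rw [tpoly_eval]
  rcases i with _ | i
  · simp
  · simp only [Nat.add_sub_cancel, Pi.pow_apply]; push_cast; ring

theorem PData.wInt (D : PData P f μ δ β γ J) (i : ℕ) (p : Polynomial ℝ) :
    Integrable (fun x => p.eval x * (pq δ β γ x ^ i * f x)) volume := by
  have := (D.intP _).1 (D.polyInt (p * qpoly δ β γ ^ i))
  refine this.congr (Eventually.of_forall fun x => ?_)
  simp only [Polynomial.eval_mul, Polynomial.eval_pow, qpoly_eval]; ring

theorem PData.Ftend (D : PData P f μ δ β γ J) (i : ℕ) :
    Tendsto (fun x => pq δ β γ x ^ i * (pq δ β γ x * f x)) (cocompact ℝ) (nhds 0) := by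
  obtain ⟨t, ht, hi, K, hK0, hK⟩ := D.expo
  obtain ⟨C, hC0, hC⟩ := poly_exp_bound (qpoly δ β γ ^ i) (half_pos ht)
  have hb : ∀ x, ‖pq δ β γ x ^ i * (pq δ β γ x * f x)‖ ≤ C * K * Real.exp (-(t / 2) * ‖x‖) := by
    intro x
    rw [norm_mul, Real.norm_of_nonneg (D.u0 x), Real.norm_eq_abs]
    have := hC x
    rw [Polynomial.eval_pow, qpoly_eval] at this
    calc _ ≤ (C * Real.exp (t / 2 * |x|)) * (K * Real.exp (-t * |x|)) :=
          mul_le_mul this (hK x) (D.u0 x) (by positivity)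
      _ = C * K * (Real.exp (t / 2 * |x|) * Real.exp (-t * |x|)) := by ring
      _ = _ := by rw [← Real.exp_add, Real.norm_eq_abs]; congr 2; ring
  refine squeeze_zero_norm hb ?_
  have h1 : Tendsto (fun x : ℝ => -(t / 2) * ‖x‖) (cocompact ℝ) atBot :=
    (tendsto_norm_cocompact_atTop).const_mul_atTop_of_neg (by linarith)
  have := (Real.tendsto_exp_atBot.comp h1).const_mul (C * K)
  simpa using this

theorem PData.Fcont (D : PData P f μ δ β γ J) (i : ℕ) :
    Continuous (fun x => pq δ β γ x ^ i * (pq δ β γ x * f x)) :=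
  ((pq_cont δ β γ).pow i).mul D.ucont

theorem PData.Fftc (D : PData P f μ δ β γ J) (i : ℕ) (a b : ℝ) :
    ∫ x in a..b, (tpoly μ δ β i).eval x * (pq δ β γ x ^ i * f x) =
      pq δ β γ b ^ i * (pq δ β γ b * f b) - pq δ β γ a ^ i * (pq δ β γ a * f a) := by
  obtain ⟨s, hs, _, hd⟩ := D.uder
  exact integral_eq_of_hasDerivAt_off_countable (fun x => pq δ β γ x ^ i * (pq δ β γ x * f x)) _ hs
    (D.Fcont i).continuousOn (fun x hx => D.Fder i (hd x hx.2)) (D.wInt i _).intervalIntegrable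

theorem PData.Fiic (D : PData P f μ δ β γ J) (i : ℕ) (b : ℝ) :
    ∫ x in Set.Iic b, (tpoly μ δ β i).eval x * (pq δ β γ x ^ i * f x) =
      pq δ β γ b ^ i * (pq δ β γ b * f b) := by
  have h1 := intervalIntegral_tendsto_integral_Iic b (D.wInt i (tpoly μ δ β i)).integrableOn tendsto_id
  have h2 := tendsto_const_nhds (x := pq δ β γ b ^ i * (pq δ β γ b * f b)) |>.sub
    ((D.Ftend i).mono_left (atBot_le_cocompact))
  rw [sub_zero] at h2
  refine tendsto_nhds_unique h1 (h2.congr fun a => ?_)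
  exact (D.Fftc i a b).symm

theorem PData.Ftot (D : PData P f μ δ β γ J) (i : ℕ) :
    ∫ x, (tpoly μ δ β i).eval x * (pq δ β γ x ^ i * f x) = 0 := by
  have h1 := intervalIntegral_tendsto_integral (D.wInt i (tpoly μ δ β i)) tendsto_neg_atTop_atBot tendsto_id
  have h2 := ((D.Ftend i).mono_left (atTop_le_cocompact)).sub
    (((D.Ftend i).mono_left (atBot_le_cocompact)).comp tendsto_neg_atTop_atBot)
  rw [sub_zero] at h2
  refine tendsto_nhds_unique h1 (h2.congr fun a => ?_)
  exact (D.Fftc i _ _).symm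

theorem PData.w0 (D : PData P f μ δ β γ J) (i : ℕ) (x : ℝ) : 0 ≤ pq δ β γ x ^ i * f x := by
  by_cases hx : x ∈ J
  · exact mul_nonneg (pow_nonneg (D.qpos x hx).le i) (D.f0 x)
  · rw [D.foff x hx, mul_zero]

theorem PData.tzero_mem (D : PData P f μ δ β γ J) (i : ℕ) : tzero μ δ β i ∈ J := by
  by_contra hc
  set c := tzero μ δ β i with hcdef
  set φ : ℝ → ℝ := fun x => (tpoly μ δ β i).eval x * (pq δ β γ x ^ i * f x) with hφ
  have hk := kap_pos D.hδ i
  have hF : ∀ b ∈ J, 0 < pq δ β γ b ^ i * (pq δ β γ b * f b) := fun b hb =>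
    mul_pos (pow_pos (D.qpos b hb) i) (mul_pos (D.qpos b hb) (D.fpos b hb))
  have hFc : pq δ β γ c ^ i * (pq δ β γ c * f c) = 0 := by rw [D.foff c hc]; ring
  obtain ⟨b, hb⟩ := D.ne
  have hFb := hF b hb
  have h1 := D.Fiic i b
  have h2 := D.Ftot i
  have hIntg := D.wInt i (tpoly μ δ β i)
  have hsplit := integral_add_compl (measurableSet_Iic (a := b)) hIntg
  rcases lt_or_ge b c with hbc | hbc
  · -- J lies left of c: the tail integral is nonnegative
    have hleft : ∀ x, 0 ≤ φ x := by
      intro x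
      by_cases hx : x ∈ J
      · have : x < c := by
          by_contra hxc
          exact hc (D.conn.out hb hx ⟨hbc.le, not_lt.1 hxc⟩)
        simp only [hφ, tpoly_eval' D.hδ]
        exact mul_nonneg (mul_nonneg hk.le (by linarith)) (D.w0 i x)
      · simp [hφ, D.foff x hx]
    have : 0 ≤ ∫ x in (Set.Iic b)ᶜ, φ x := integral_nonneg (fun x => hleft x)
    simp only [hφ] at this
    linarith
  · have hright : ∀ x, φ x ≤ 0 := by
      intro x
      by_cases hx : x ∈ J
      · have : c < x := by
          by_contra hxc
          exact hc (D.conn.out hx hb ⟨not_lt.1 hxc, hbc⟩)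
        simp only [hφ, tpoly_eval' D.hδ]
        exact mul_nonpos_of_nonpos_of_nonneg (mul_nonpos_of_nonneg_of_nonpos hk.le (by linarith)) (D.w0 i x)
      · simp [hφ, D.foff x hx]
    have : ∫ x in (Set.Iic b), φ x ≤ 0 := integral_nonpos (fun x => hright x)
    simp only [hφ] at this
    linarith

end

section
variable {P : Measure ℝ} {f : ℝ → ℝ} {μ δ β γ : ℝ} {J : Set ℝ}

theorem PData.stein (D : PData P f μ δ β γ J) (i : ℕ) (h h' : ℝ → ℝ)
    (hd : ∀ x ∈ J, HasDerivAt h (h' x) x) (hc : ContinuousOn h' J)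
    (hi : Integrable (fun x => pq δ β γ x ^ (i + 1) * h' x) P) :
    Integrable (fun x => (tpoly μ δ β i).eval x * (pq δ β γ x ^ i * h x)) P ∧
    ∫ x, (tpoly μ δ β i).eval x * (pq δ β γ x ^ i * h x) ∂P =
      - ∫ x, pq δ β γ x ^ (i + 1) * h' x ∂P := by
  classical
  set c := tzero μ δ β i with hcdef
  have hcJ : c ∈ J := D.tzero_mem i
  set T : ℝ → ℝ := fun x => (tpoly μ δ β i).eval x * (pq δ β γ x ^ i * f x) with hT
  have hTi : Integrable T volume := D.wInt i _
  have hTm : Measurable T :=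
    (Continuous.measurable (by fun_prop)).mul (((pq_cont δ β γ).measurable.pow_const i).mul D.fmeas)
  set k : ℝ → ℝ := J.indicator h' with hk
  have hkm : Measurable k := by
    have h1 : Measurable (J.piecewise h' (fun _ => 0)) :=
      hc.measurable_piecewise continuous_const.continuousOn D.opn.measurableSet
    have : J.piecewise h' (fun _ => 0) = k := by
      ext x
      by_cases hx : x ∈ J <;> simp [hx, hk]
    rwa [this] at h1
  set F : ℝ → ℝ := fun x => pq δ β γ x ^ i * (pq δ β γ x * f x) with hF
  have hF0 : ∀ x, 0 ≤ F x := by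
    intro x
    have h1 := D.w0 (i + 1) x
    have : F x = pq δ β γ x ^ (i + 1) * f x := by simp only [hF]; ring
    rw [this]; exact h1
  have hFk : Integrable (fun t => F t * k t) volume := by
    refine ((D.intP _).1 hi).congr (Eventually.of_forall fun x => ?_)
    by_cases hx : x ∈ J
    · simp only [hF, hk, Set.indicator_of_mem hx]; ring
    · simp only [hF, D.foff x hx]; ring
  set σ : ℝ → ℝ → ℝ := fun x t => (if c < t ∧ t ≤ x then 1 else 0) - (if x < t ∧ t ≤ c then 1 else 0) with hσ
  have hσm : Measurable (Function.uncurry σ) := by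
    refine Measurable.sub ?_ ?_
    · refine Measurable.ite ?_ measurable_const measurable_const
      exact (measurableSet_lt measurable_const measurable_snd).inter (measurableSet_le measurable_snd measurable_fst)
    · refine Measurable.ite ?_ measurable_const measurable_const
      exact (measurableSet_lt measurable_fst measurable_snd).inter (measurableSet_le measurable_snd measurable_const)
  have hsign : ∀ x t, σ x t * T x ≤ 0 := by
    intro x t
    have hw := D.w0 i x
    have hkp := kap_pos D.hδ i
    have hTx : T x = (1 - 2 * i * δ) * (pq δ β γ x ^ i * f x) * (c - x) := by
      simp only [hT, tpoly_eval' D.hδ]; ring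
    have hp := mul_nonneg hkp.le hw
    simp only [hσ]
    split_ifs with h1 h2 h2
    · linarith [h1.1, h1.2, h2.1]
    · rw [hTx]; nlinarith [h1.1, h1.2]
    · rw [hTx]; nlinarith [h2.1, h2.2]
    · simp
  have hσT : ∀ t, Integrable (fun x => σ x t * T x) volume ∧ ∫ x, σ x t * T x = - F t := by
    intro t
    rcases lt_or_ge c t with ht | ht
    · have e : (fun x => σ x t * T x) = (Set.Ici t).indicator T := by
        ext x
        by_cases hx : t ≤ x
        · simp [hσ, hx, ht, not_lt.2 hx, Set.indicator]
        · simp [hσ, hx, Set.indicator, not_le.2 ht]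
      rw [e]
      refine ⟨hTi.indicator measurableSet_Ici, ?_⟩
      rw [integral_indicator measurableSet_Ici, integral_Ici_eq_integral_Ioi]
      have := integral_add_compl (measurableSet_Iic (a := t)) hTi
      rw [D.Ftot i, D.Fiic i t, Set.compl_Iic] at this
      linarith
    · have e : (fun x => σ x t * T x) = fun x => - (Set.Iio t).indicator T x := by
        ext x
        by_cases hx : x < t
        · simp [hσ, hx, ht, not_lt.2 ht, Set.indicator]
        · simp [hσ, hx, Set.indicator, not_lt.2 ht]
      rw [e]
      refine ⟨(hTi.indicator measurableSet_Iio).neg, ?_⟩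
      rw [integral_neg, integral_indicator measurableSet_Iio, ← integral_Iic_eq_integral_Iio, D.Fiic i t]
  have hσk : ∀ x ∈ J, ∫ t, σ x t * k t = h x - h c := by
    intro x hx
    have hsub : Set.uIcc c x ⊆ J := D.conn.uIcc_subset hcJ hx
    have hftc : ∫ t in c..x, h' t = h x - h c :=
      intervalIntegral.integral_eq_sub_of_hasDerivAt (fun y hy => hd y (hsub hy))
        ((hc.mono hsub).intervalIntegrable)
    have hftc' : ∫ t in c..x, k t = h x - h c := by
      rw [← hftc]
      refine intervalIntegral.integral_congr fun y hy => ?_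
      simp [hk, hsub hy]
    rw [← hftc']
    rcases le_total c x with hcx | hcx
    · rw [intervalIntegral.integral_of_le hcx, ← integral_indicator measurableSet_Ioc]
      congr 1; ext t
      by_cases ht : c < t ∧ t ≤ x
      · have : ¬ (x < t ∧ t ≤ c) := fun h => by linarith [h.1, ht.2]
        simp only [hσ, if_pos ht, if_neg this, Set.indicator_of_mem (show t ∈ Set.Ioc c x from ht)]; ring
      · have : ¬ (x < t ∧ t ≤ c) := fun h => by linarith [h.1, h.2]
        simp only [hσ, if_neg ht, if_neg this, Set.indicator_of_notMem (show t ∉ Set.Ioc c x from ht)]; ring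
    · rw [intervalIntegral.integral_of_ge hcx, ← integral_indicator measurableSet_Ioc, ← integral_neg]
      congr 1; ext t
      have h0 : ¬ (c < t ∧ t ≤ x) := fun h => by linarith [h.1, h.2]
      by_cases ht : x < t ∧ t ≤ c
      · simp only [hσ, if_pos ht, if_neg h0, Set.indicator_of_mem (show t ∈ Set.Ioc x c from ht)]; ring
      · simp only [hσ, if_neg ht, if_neg h0, Set.indicator_of_notMem (show t ∉ Set.Ioc x c from ht)]; ring
  set K : ℝ × ℝ → ℝ := fun z => σ z.1 z.2 * T z.1 * k z.2 with hK
  have hKm : Measurable K :=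
    (hσm.mul (hTm.comp measurable_fst)).mul (hkm.comp measurable_snd)
  have hKi : Integrable K (volume.prod volume) := by
    rw [integrable_prod_iff' hKm.aestronglyMeasurable]
    constructor
    · exact Eventually.of_forall fun t => (hσT t).1.mul_const (k t)
    · refine hFk.norm.congr (Eventually.of_forall fun t => ?_)
      have : ∀ x, ‖K (x, t)‖ = -(σ x t * T x) * |k t| := by
        intro x
        simp only [hK, norm_mul (σ x t * T x), Real.norm_eq_abs]
        rw [abs_of_nonpos (hsign x t)]
      simp only [this]
      rw [integral_mul_const, integral_neg, (hσT t).2, neg_neg, norm_mul, Real.norm_of_nonneg (hF0 t), Real.norm_eq_abs]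
  have hleft := hKi.integral_prod_left
  have hinner : ∀ x, ∫ t, K (x, t) = T x * h x - h c * T x := by
    intro x
    by_cases hx : x ∈ J
    · have : ∀ t, K (x, t) = T x * (σ x t * k t) := fun t => by simp only [hK]; ring
      simp only [this]
      rw [integral_const_mul, hσk x hx]; ring
    · have hT0 : T x = 0 := by simp [hT, D.foff x hx]
      simp [hK, hT0]
  simp only [hinner] at hleft
  have hTh : Integrable (fun x => T x * h x) volume := by
    refine (hleft.add (hTi.const_mul (h c))).congr (Eventually.of_forall fun x => ?_)
    simp
  have hval : ∫ x, T x * h x = - ∫ t, F t * k t := by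
    have h1 := integral_integral_swap (f := fun x t => K (x, t)) hKi
    have h2 : ∫ x, ∫ t, K (x, t) = ∫ x, T x * h x := by
      simp only [hinner]
      rw [integral_sub hTh (hTi.const_mul _), integral_const_mul, D.Ftot i]; ring
    have h3 : ∫ t, ∫ x, K (x, t) = - ∫ t, F t * k t := by
      rw [← integral_neg]
      congr 1; ext t
      simp only [hK]
      rw [integral_mul_const, (hσT t).2]; ring
    rw [← h2, ← h3]; exact h1
  have eT : (fun x => (tpoly μ δ β i).eval x * (pq δ β γ x ^ i * h x) * f x) = fun x => T x * h x := by
    ext x; simp only [hT]; ring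
  refine ⟨?_, ?_⟩
  · rw [D.intP, eT]; exact hTh
  · rw [D.integP, D.integP, eT, hval]
    congr 2; ext x
    by_cases hx : x ∈ J
    · simp only [hF, hk, Set.indicator_of_mem hx]; ring
    · simp only [hF, D.foff x hx]; ring

end

section
variable {P : Measure ℝ} {f : ℝ → ℝ} {μ δ β γ : ℝ} {J : Set ℝ}

theorem PData.aesm (D : PData P f μ δ β γ J) {φ : ℝ → ℝ} (hφ : ContinuousOn φ J) :
    AEStronglyMeasurable φ P := by
  have := hφ.aestronglyMeasurable (μ := P) D.opn.measurableSet
  rwa [Measure.restrict_eq_self_of_ae_mem D.memJ] at this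

theorem PData.stein_int (D : PData P f μ δ β γ J) (i : ℕ) (h h' : ℝ → ℝ)
    (hd : ∀ x ∈ J, HasDerivAt h (h' x) x) (hc : ContinuousOn h' J)
    (hi : Integrable (fun x => pq δ β γ x ^ (i + 1) * h' x) P) :
    Integrable (fun x => pq δ β γ x ^ i * h x) P ∧
    Integrable (fun x => pq δ β γ x ^ i * (x * h x)) P := by
  have hS := (D.stein i h h' hd hc hi).1
  have := D.prob
  set c := tzero μ δ β i with hcdef
  have hcJ : c ∈ J := D.tzero_mem i
  have hhc : ContinuousOn h J := fun x hx => (hd x hx).continuousAt.continuousWithinAt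
  have hqh : ContinuousOn (fun x => pq δ β γ x ^ i * h x) J :=
    ((pq_cont δ β γ).pow i).continuousOn.mul hhc
  obtain ⟨ε, hε, hball⟩ := Metric.isOpen_iff.1 D.opn c hcJ
  have hsub : Set.Icc (c - ε / 2) (c + ε / 2) ⊆ J := by
    intro y hy
    apply hball
    rw [Metric.mem_ball, Real.dist_eq, abs_lt]
    constructor <;> linarith [hy.1, hy.2]
  obtain ⟨M, hM⟩ := isCompact_Icc.exists_bound_of_continuousOn (hqh.mono hsub)
  have hM0 : 0 ≤ M := (norm_nonneg _).trans (hM c ⟨by linarith, by linarith⟩)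
  have hkp := kap_pos D.hδ i
  set η := (1 - 2 * i * δ) * (ε / 2) with hη
  have hη0 : 0 < η := by positivity
  have h1 : Integrable (fun x => pq δ β γ x ^ i * h x) P := by
    refine ((integrable_const M).add (hS.norm.const_mul η⁻¹)).mono' (D.aesm hqh) ?_
    refine Eventually.of_forall fun x => ?_
    simp only [Pi.add_apply]
    by_cases hx : x ∈ Set.Icc (c - ε / 2) (c + ε / 2)
    · have := hM x hx
      have h2 : 0 ≤ η⁻¹ * ‖(tpoly μ δ β i).eval x * (pq δ β γ x ^ i * h x)‖ := by positivity
      linarith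
    · have hτ : η ≤ |(tpoly μ δ β i).eval x| := by
        rw [tpoly_eval' D.hδ, abs_mul, abs_of_pos hkp, hη]
        refine mul_le_mul_of_nonneg_left ?_ hkp.le
        rw [← hcdef]
        by_contra hlt
        push Not at hlt
        rw [abs_lt] at hlt
        exact hx ⟨by linarith [hlt.2], by linarith [hlt.1]⟩
      rw [norm_mul ((tpoly μ δ β i).eval x), ← mul_assoc]
      have : 1 ≤ η⁻¹ * ‖(tpoly μ δ β i).eval x‖ := by
        rw [inv_mul_eq_div, le_div_iff₀ hη0, one_mul]; exact hτ
      have := le_mul_of_one_le_left (norm_nonneg (pq δ β γ x ^ i * h x)) this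
      linarith
  refine ⟨h1, ?_⟩
  refine ((h1.const_mul c).sub (hS.const_mul (1 - 2 * i * δ)⁻¹)).congr (Eventually.of_forall fun x => ?_)
  simp only [Pi.sub_apply, tpoly_eval' D.hδ, ← hcdef]
  field_simp
  ring

theorem cs_interval {k : ℝ → ℝ} {a b : ℝ} (hk : ContinuousOn k (Set.uIcc a b)) :
    (∫ t in a..b, k t) ^ 2 ≤ |b - a| * |∫ t in a..b, k t ^ 2| := by
  wlog hab : a ≤ b generalizing a b with H
  · have := H (a := b) (b := a) (by rwa [Set.uIcc_comm]) (le_of_not_ge hab)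
    rw [intervalIntegral.integral_symm a b, intervalIntegral.integral_symm a b (f := fun t => k t ^ 2), abs_neg, abs_sub_comm] at this
    simpa using this
  rcases eq_or_lt_of_le hab with rfl | hlt
  · simp
  set I := ∫ t in a..b, k t
  have hl : 0 < b - a := by linarith
  have h0 : 0 ≤ ∫ t in a..b, (k t - I / (b - a)) ^ 2 :=
    intervalIntegral.integral_nonneg hab (fun t _ => sq_nonneg _)
  have hki : IntervalIntegrable k volume a b := hk.intervalIntegrable
  have hk2 : IntervalIntegrable (fun t => k t ^ 2) volume a b := (hk.pow 2).intervalIntegrable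
  have e : ∫ t in a..b, (k t - I / (b - a)) ^ 2 = (∫ t in a..b, k t ^ 2) - I ^ 2 / (b - a) := by
    have : (fun t => (k t - I / (b - a)) ^ 2) = fun t => k t ^ 2 - (2 * (I / (b - a))) * k t + (I / (b - a)) ^ 2 := by
      ext t; ring
    rw [this, intervalIntegral.integral_add (hk2.sub (hki.const_mul _)) (by simp),
      intervalIntegral.integral_sub hk2 (hki.const_mul _), intervalIntegral.integral_const_mul,
      intervalIntegral.integral_const, smul_eq_mul]
    change _ - 2 * (I / (b - a)) * I + _ = _
    field_simp
    ring
  rw [e] at h0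
  have h1 : I ^ 2 ≤ (b - a) * ∫ t in a..b, k t ^ 2 := by
    have : I ^ 2 / (b - a) ≤ ∫ t in a..b, k t ^ 2 := by linarith
    rw [div_le_iff₀ hl] at this; linarith
  rw [abs_of_pos hl]
  exact h1.trans (mul_le_mul_of_nonneg_left (le_abs_self _) hl.le)

theorem PData.l2chain (D : PData P f μ δ β γ J) (i : ℕ) (h h' : ℝ → ℝ)
    (hd : ∀ x ∈ J, HasDerivAt h (h' x) x) (hc : ContinuousOn h' J)
    (hi : Integrable (fun x => pq δ β γ x ^ (i + 1) * h' x ^ 2) P) :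
    Integrable (fun x => pq δ β γ x ^ i * h x ^ 2) P := by
  set c := tzero μ δ β i with hcdef
  have hcJ : c ∈ J := D.tzero_mem i
  have hkp := kap_pos D.hδ i
  have hhc : ContinuousOn h J := fun x hx => (hd x hx).continuousAt.continuousWithinAt
  set H : ℝ → ℝ := fun x => ∫ t in c..x, h' t ^ 2 with hH
  have hsub : ∀ x ∈ J, Set.uIcc c x ⊆ J := fun x hx => D.conn.uIcc_subset hcJ hx
  have hc2 : ContinuousOn (fun x => h' x ^ 2) J := hc.pow 2
  have hHd : ∀ x ∈ J, HasDerivAt H (h' x ^ 2) x := by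
    intro x hx
    refine intervalIntegral.integral_hasDerivAt_right ((hc2.mono (hsub x hx)).intervalIntegrable) ?_
      (hc2.continuousAt (D.opn.mem_nhds hx))
    exact hc2.stronglyMeasurableAtFilter D.opn x hx
  have hS := (D.stein i H _ hHd hc2 hi).1
  have hqi : Integrable (fun x => pq δ β γ x ^ i) P := by
    refine (D.polyInt (qpoly δ β γ ^ i)).congr (Eventually.of_forall fun x => ?_)
    simp [qpoly_eval]
  refine ((hS.norm.const_mul (2 * (1 - 2 * i * δ)⁻¹)).add (hqi.const_mul (2 * h c ^ 2))).mono'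
    (D.aesm (((pq_cont δ β γ).pow i).continuousOn.mul (hhc.pow 2))) ?_
  filter_upwards [D.memJ] with x hx
  have hq0 : 0 ≤ pq δ β γ x ^ i := pow_nonneg (D.qpos x hx).le i
  have hftc : ∫ t in c..x, h' t = h x - h c :=
      intervalIntegral.integral_eq_sub_of_hasDerivAt (fun y hy => hd y (hsub x hx hy))
        ((hc.mono (hsub x hx)).intervalIntegrable)
  have hcs := cs_interval (hc.mono (hsub x hx))
  rw [hftc] at hcs
  simp only [Pi.add_apply]
  rw [Real.norm_of_nonneg (by positivity), norm_mul, norm_mul, Real.norm_of_nonneg hq0, tpoly_eval' D.hδ, norm_mul,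
    Real.norm_of_nonneg hkp.le, Real.norm_eq_abs, Real.norm_eq_abs, ← hcdef, abs_sub_comm c x]
  have e : 2 * (1 - 2 * i * δ)⁻¹ * ((1 - 2 * i * δ) * |x - c| * (pq δ β γ x ^ i * |H x|)) + 2 * h c ^ 2 * pq δ β γ x ^ i
      = pq δ β γ x ^ i * (2 * (|x - c| * |H x|) + 2 * h c ^ 2) := by
    field_simp
  rw [e]
  refine mul_le_mul_of_nonneg_left ?_ hq0
  have : (|x - c| * |H x|) = |x - c| * |∫ t in c..x, h' t ^ 2| := rfl
  rw [this]
  nlinarith [sq_nonneg (h x - 2 * h c)]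

structure GData (P : Measure ℝ) (q : ℝ → ℝ) (J : Set ℝ) (gd : ℕ → ℝ → ℝ) : Prop where
  der : ∀ k, ∀ x ∈ J, HasDerivAt (gd k) (gd (k + 1) x) x
  int : ∀ i, Integrable (fun x => q x ^ i * gd i x) P

theorem GData.cont {q : ℝ → ℝ} {gd : ℕ → ℝ → ℝ} (G : GData P q J gd) (k : ℕ) : ContinuousOn (gd k) J :=
  fun x hx => (G.der k x hx).continuousAt.continuousWithinAt

theorem PData.gdata (D : PData P f μ δ β γ J) {gd : ℕ → ℝ → ℝ}
    (der : ∀ k, ∀ x ∈ J, HasDerivAt (gd k) (gd (k + 1) x) x) (n : ℕ)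
    (hIntg : ∀ i, n < i → Integrable (fun x => pq δ β γ x ^ i * gd i x) P) :
    GData P (pq δ β γ) J gd := by
  refine ⟨der, ?_⟩
  have hcont : ∀ k, ContinuousOn (gd k) J := fun k x hx => (der k x hx).continuousAt.continuousWithinAt
  have : ∀ d i, n < i + d → Integrable (fun x => pq δ β γ x ^ i * gd i x) P := by
    intro d
    induction d with
    | zero => intro i hi; exact hIntg i hi
    | succ d ih =>
      intro i hi
      exact (D.stein_int i (gd i) (gd (i + 1)) (der i) (hcont _) (ih (i + 1) (by omega))).1
  exact fun i => this (n + 1) i (by omega)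

theorem PData.gpow (D : PData P f μ δ β γ J) {gd : ℕ → ℝ → ℝ} (G : GData P (pq δ β γ) J gd) (d : ℕ) :
    ∀ i, Integrable (fun x => pq δ β γ x ^ i * (x ^ d * gd i x)) P := by
  induction d using Nat.strong_induction_on with
  | _ d ih =>
    intro i
    rcases d with _ | d
    · simpa using G.int i
    have hder : ∀ x ∈ J, HasDerivAt (fun x => x ^ d * gd i x) (d * x ^ (d - 1) * gd i x + x ^ d * gd (i + 1) x) x := by
      intro x hx
      exact (hasDerivAt_pow d x).mul (G.der i x hx)
    have hcont : ContinuousOn (fun x => d * x ^ (d - 1) * gd i x + x ^ d * gd (i + 1) x) J :=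
      ((by fun_prop : Continuous fun x : ℝ => (d : ℝ) * x ^ (d - 1)).continuousOn.mul (G.cont i)).add
        ((continuous_pow d).continuousOn.mul (G.cont (i + 1)))
    have h2 := ih d (by omega) (i + 1)
    have h1 : Integrable (fun x => pq δ β γ x ^ (i + 1) * (d * x ^ (d - 1) * gd i x)) P := by
      rcases d with _ | d
      · simp
      have ha := ih (d + 1) (by omega) i
      have hb := ih d (by omega) i
      simp only [Nat.add_sub_cancel]
      refine (((ha.norm.const_mul |β|).add (hb.norm.const_mul |γ|)).const_mul ((d + 1 : ℕ) : ℝ)).mono'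
        (D.aesm ?_) ?_
      · exact ((pq_cont δ β γ).pow _).continuousOn.mul
          ((by fun_prop : Continuous fun x : ℝ => ((d + 1 : ℕ) : ℝ) * x ^ d).continuousOn.mul (G.cont i))
      · filter_upwards [D.memJ] with x hx
        have hq0 := D.qpos x hx
        have hq := pq_le (β := β) (γ := γ) D.hδ x
        simp only [Pi.add_apply, norm_mul, norm_pow, Real.norm_eq_abs]
        rw [abs_of_pos hq0, Nat.abs_cast]
        have h3 : 0 ≤ pq δ β γ x ^ i * (((d + 1 : ℕ) : ℝ) * |x| ^ d * |gd i x|) := by positivity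
        have := mul_le_mul_of_nonneg_left hq h3
        calc _ = pq δ β γ x ^ i * (((d + 1 : ℕ) : ℝ) * |x| ^ d * |gd i x|) * pq δ β γ x := by ring
          _ ≤ _ := this
          _ = _ := by ring
    refine (D.stein_int i _ _ hder hcont ?_).2.congr (Eventually.of_forall fun x => ?_)
    · refine (h1.add h2).congr (Eventually.of_forall fun x => ?_)
      simp only [Pi.add_apply]; ring
    · simp only; ring

theorem PData.gpoly (D : PData P f μ δ β γ J) {gd : ℕ → ℝ → ℝ} (G : GData P (pq δ β γ) J gd)
    (p : Polynomial ℝ) (i : ℕ) : Integrable (fun x => pq δ β γ x ^ i * (p.eval x * gd i x)) P := by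
  induction p using Polynomial.induction_on' with
  | add p r hp hr =>
    refine (hp.add hr).congr (Eventually.of_forall fun x => ?_)
    simp only [Pi.add_apply, Polynomial.eval_add]; ring
  | monomial k a =>
    refine ((D.gpow G k i).const_mul a).congr (Eventually.of_forall fun x => ?_)
    simp only [Polynomial.eval_monomial]; ring

/-- adjoint of the derivative -/
def Dop (μ δ β γ : ℝ) (i : ℕ) (p : Polynomial ℝ) : Polynomial ℝ :=
  -(tpoly μ δ β i * p + qpoly δ β γ * Polynomial.derivative p)

theorem PData.ibp (D : PData P f μ δ β γ J) {gd : ℕ → ℝ → ℝ} (G : GData P (pq δ β γ) J gd)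
    (p : Polynomial ℝ) (i : ℕ) :
    ∫ x, pq δ β γ x ^ (i + 1) * (p.eval x * gd (i + 1) x) ∂P =
      ∫ x, pq δ β γ x ^ i * ((Dop μ δ β γ i p).eval x * gd i x) ∂P := by
  have hder : ∀ x ∈ J, HasDerivAt (fun x => p.eval x * gd i x) (p.derivative.eval x * gd i x + p.eval x * gd (i + 1) x) x := by
    intro x hx
    exact (p.hasDerivAt x).mul (G.der i x hx)
  have hcont : ContinuousOn (fun x => p.derivative.eval x * gd i x + p.eval x * gd (i + 1) x) J :=
    (p.derivative.continuous.continuousOn.mul (G.cont i)).add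
      (p.continuous.continuousOn.mul (G.cont (i + 1)))
  have h2 := D.gpoly G p (i + 1)
  have h1 : Integrable (fun x => pq δ β γ x ^ (i + 1) * (p.derivative.eval x * gd i x)) P := by
    refine (D.gpoly G (qpoly δ β γ * p.derivative) i).congr (Eventually.of_forall fun x => ?_)
    simp only [Polynomial.eval_mul, qpoly_eval]; ring
  have h12 : Integrable (fun x => pq δ β γ x ^ (i + 1) * (p.derivative.eval x * gd i x + p.eval x * gd (i + 1) x)) P := by
    refine (h1.add h2).congr (Eventually.of_forall fun x => ?_)
    simp only [Pi.add_apply]; ring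
  obtain ⟨hS1, hS2⟩ := D.stein i _ _ hder hcont h12
  have e1 : ∫ x, pq δ β γ x ^ (i + 1) * (p.derivative.eval x * gd i x + p.eval x * gd (i + 1) x) ∂P =
      ∫ x, pq δ β γ x ^ (i + 1) * (p.derivative.eval x * gd i x) ∂P + ∫ x, pq δ β γ x ^ (i + 1) * (p.eval x * gd (i + 1) x) ∂P := by
    rw [← integral_add h1 h2]; congr 1; ext x; ring
  have e2 : ∫ x, pq δ β γ x ^ i * ((Dop μ δ β γ i p).eval x * gd i x) ∂P =
     -(∫ x, (tpoly μ δ β i).eval x * (pq δ β γ x ^ i * (p.eval x * gd i x)) ∂P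
       + ∫ x, pq δ β γ x ^ (i + 1) * (p.derivative.eval x * gd i x) ∂P) := by
    rw [← integral_add hS1 h1, ← integral_neg]
    congr 1; ext x
    simp only [Dop, Polynomial.eval_neg, Polynomial.eval_add, Polynomial.eval_mul, qpoly_eval]; ring
  rw [e2, hS2, e1]; ring

end

section
variable {P : Measure ℝ} {f : ℝ → ℝ} {μ δ β γ : ℝ} {J : Set ℝ}

def Qp (μ δ β γ : ℝ) : ℕ → ℕ → Polynomial ℝ
  | _, 0 => 1
  | i, d + 1 => Dop μ δ β γ i (Qp μ δ β γ (i + 1) d)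

theorem Dop_coeff (μ δ β γ : ℝ) (i : ℕ) (p : Polynomial ℝ) (m : ℕ) :
    (Dop μ δ β γ i p).coeff (m + 1) = (1 - (2 * i + m) * δ) * p.coeff m
      - ((μ + i * β + β * (m + 1)) * p.coeff (m + 1) + γ * (m + 2) * p.coeff (m + 2)) := by
  have h1 : Dop μ δ β γ i p = -(Polynomial.C (μ + i * β) * p - Polynomial.C (1 - 2 * i * δ) * (Polynomial.X * p)
      + Polynomial.C δ * (Polynomial.X ^ 2 * Polynomial.derivative p)
      + Polynomial.C β * (Polynomial.X * Polynomial.derivative p) + Polynomial.C γ * Polynomial.derivative p) := by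
    unfold Dop tpoly qpoly
    simp only [Polynomial.C_add, Polynomial.C_mul, Polynomial.C_sub, Polynomial.C_1]
    ring
  have h2 : (Polynomial.X ^ 2 * Polynomial.derivative p).coeff (m + 1) = m * p.coeff m := by
    rw [Polynomial.coeff_X_pow_mul']
    rcases m with _ | m
    · simp
    · rw [if_pos (by omega), show m + 1 + 1 - 2 = m by omega, Polynomial.coeff_derivative]
      push_cast; ring
  rw [h1]
  simp only [Polynomial.coeff_neg, Polynomial.coeff_add, Polynomial.coeff_sub, Polynomial.coeff_C_mul,
    Polynomial.coeff_X_mul, h2, Polynomial.coeff_derivative]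
  push_cast
  ring

theorem Qp_coeff (μ δ β γ : ℝ) (d : ℕ) : ∀ i, (∀ m, d < m → (Qp μ δ β γ i d).coeff m = 0) ∧
    (Qp μ δ β γ i d).coeff d = pp δ (2 * i + d - 1) d := by
  induction d with
  | zero =>
    intro i
    refine ⟨fun m hm => ?_, ?_⟩
    · simp [Qp, Polynomial.coeff_one, hm.ne']
    · simp [Qp, pp]
  | succ d ih =>
    intro i
    obtain ⟨h1, h2⟩ := ih (i + 1)
    refine ⟨fun m hm => ?_, ?_⟩
    · obtain ⟨m, rfl⟩ : ∃ k, m = k + 1 := ⟨m - 1, by omega⟩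
      rw [Qp, Dop_coeff, h1 m (by omega), h1 (m + 1) (by omega), h1 (m + 2) (by omega)]; ring
    · rw [Qp, Dop_coeff, h2, h1 (d + 1) (by omega), h1 (d + 2) (by omega)]
      unfold pp
      rw [Finset.prod_range_succ']
      push_cast
      have : ∀ j ∈ Finset.range d, (1 - (2 * (i + 1 : ℝ) + d - 1 + j) * δ) = (1 - (2 * (i : ℝ) + (d + 1) - 1 + (j + 1)) * δ) := by
        intro j _; ring
      rw [Finset.prod_congr rfl this]
      ring

theorem PData.pibp (D : PData P f μ δ β γ J) (p r : Polynomial ℝ) (i : ℕ) :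
    ∫ x, pq δ β γ x ^ (i + 1) * (p.eval x * r.derivative.eval x) ∂P =
      ∫ x, pq δ β γ x ^ i * ((Dop μ δ β γ i p).eval x * r.eval x) ∂P := by
  have hder : ∀ x ∈ J, HasDerivAt (fun x => (p * r).eval x) ((p * r).derivative.eval x) x := 
    fun x _ => (p * r).hasDerivAt x
  have hI : ∀ s : Polynomial ℝ, ∀ k, Integrable (fun x => pq δ β γ x ^ k * s.eval x) P := by
    intro s k
    refine (D.polyInt (qpoly δ β γ ^ k * s)).congr (Eventually.of_forall fun x => ?_)
    simp [qpoly_eval]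
  obtain ⟨hS1, hS2⟩ := D.stein i _ _ hder (p * r).derivative.continuous.continuousOn (hI _ _)
  have e1 : ∫ x, pq δ β γ x ^ (i + 1) * (p * r).derivative.eval x ∂P =
      ∫ x, pq δ β γ x ^ (i + 1) * (p.derivative * r).eval x ∂P + ∫ x, pq δ β γ x ^ (i + 1) * (p * r.derivative).eval x ∂P := by
    rw [← integral_add (hI _ _) (hI _ _)]; congr 1; ext x
    rw [Polynomial.derivative_mul, Polynomial.eval_add]; ring
  have e2 : ∫ x, pq δ β γ x ^ i * ((Dop μ δ β γ i p).eval x * r.eval x) ∂P =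
     -(∫ x, (tpoly μ δ β i).eval x * (pq δ β γ x ^ i * (p * r).eval x) ∂P
       + ∫ x, pq δ β γ x ^ (i + 1) * (p.derivative * r).eval x ∂P) := by
    rw [← integral_add hS1 (hI _ _), ← integral_neg]
    congr 1; ext x
    simp only [Dop, Polynomial.eval_neg, Polynomial.eval_add, Polynomial.eval_mul, qpoly_eval]; ring
  have e3 : ∫ x, pq δ β γ x ^ (i + 1) * (p.eval x * r.derivative.eval x) ∂P = 
      ∫ x, pq δ β γ x ^ (i + 1) * (p * r.derivative).eval x ∂P := by simp
  rw [e2, hS2, e1, e3]; ring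

theorem PData.Qinner (D : PData P f μ δ β γ J) (d : ℕ) : ∀ (i : ℕ) (r : Polynomial ℝ),
    ∫ x, pq δ β γ x ^ i * ((Qp μ δ β γ i d).eval x * r.eval x) ∂P =
      ∫ x, pq δ β γ x ^ (i + d) * (Polynomial.derivative^[d] r).eval x ∂P := by
  induction d with
  | zero => intro i r; simp [Qp]
  | succ d ih =>
    intro i r
    rw [Qp, ← D.pibp, ih, Function.iterate_succ_apply]
    rw [show i + 1 + d = i + (d + 1) by ring]

theorem PData.Qg (D : PData P f μ δ β γ J) {gd : ℕ → ℝ → ℝ} (G : GData P (pq δ β γ) J gd) (d : ℕ) : ∀ (i : ℕ),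
    ∫ x, pq δ β γ x ^ i * ((Qp μ δ β γ i d).eval x * gd i x) ∂P =
      ∫ x, pq δ β γ x ^ (i + d) * gd (i + d) x ∂P := by
  induction d with
  | zero => intro i; simp [Qp]
  | succ d ih =>
    intro i
    rw [Qp, ← D.ibp G, ih]
    rw [show i + 1 + d = i + (d + 1) by ring]

theorem PData.qmom_pos (D : PData P f μ δ β γ J) (k : ℕ) : 0 < ∫ x, pq δ β γ x ^ k ∂P := by
  have := D.prob
  have hi : Integrable (fun x => pq δ β γ x ^ k) P := by
    refine (D.polyInt (qpoly δ β γ ^ k)).congr (Eventually.of_forall fun x => ?_)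
    simp [qpoly_eval]
  have hpos : ∀ᵐ x ∂P, 0 < pq δ β γ x ^ k := by
    filter_upwards [D.memJ] with x hx using pow_pos (D.qpos x hx) k
  rw [integral_pos_iff_support_of_nonneg_ae (hpos.mono fun x hx => hx.le) hi]
  have : P (Function.support fun x => pq δ β γ x ^ k) = 1 := by
    rw [prob_compl_eq_zero_iff₀ .. |>.symm]
    · exact hpos.mono fun x hx => hx.ne'
    · exact ((pq_cont δ β γ).pow k).measurable.nullMeasurable (measurableSet_singleton 0).compl
  rw [this]; exact one_pos

/-- squared norm of `Qp i d` in weight `q^i`. -/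
def Nrm (P : Measure ℝ) (δ β γ : ℝ) (i d : ℕ) : ℝ :=
  (d.factorial : ℝ) * pp δ (2 * i + d - 1) d * ∫ x, pq δ β γ x ^ (i + d) ∂P

theorem PData.Nrm_pos (D : PData P f μ δ β γ J) (i d : ℕ) : 0 < Nrm P δ β γ i d := by
  unfold Nrm
  refine mul_pos (mul_pos (by positivity) ?_) (D.qmom_pos _)
  rcases d with _ | d
  · simp [pp]
  · exact pp_pos D.hδ (by push_cast; have : (0:ℝ) ≤ i := Nat.cast_nonneg i; have : (0:ℝ) ≤ d := Nat.cast_nonneg d; linarith) _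

theorem PData.Qorth (D : PData P f μ δ β γ J) (i j k : ℕ) :
    ∫ x, pq δ β γ x ^ i * ((Qp μ δ β γ i j).eval x * (Qp μ δ β γ i k).eval x) ∂P =
      if j = k then Nrm P δ β γ i j else 0 := by
  have key : ∀ j k, k < j → ∫ x, pq δ β γ x ^ i * ((Qp μ δ β γ i j).eval x * (Qp μ δ β γ i k).eval x) ∂P = 0 := by
    intro j k hkj
    rw [D.Qinner]
    have : Polynomial.derivative^[j] (Qp μ δ β γ i k) = 0 := by
      ext m
      rw [Polynomial.coeff_iterate_derivative, (Qp_coeff μ δ β γ k i).1 _ (by omega)]; simp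
    simp [this]
  rcases lt_trichotomy j k with h | h | h
  · rw [if_neg h.ne, ← key k j h]; congr 1; ext x; ring
  · subst h
    rw [if_pos rfl, D.Qinner]
    have : Polynomial.derivative^[j] (Qp μ δ β γ i j) = Polynomial.C ((j.factorial : ℝ) * pp δ (2 * i + j - 1) j) := by
      ext m
      rw [Polynomial.coeff_iterate_derivative, Polynomial.coeff_C]
      rcases m with _ | m
      · rw [zero_add, (Qp_coeff μ δ β γ j i).2]; simp [Nat.descFactorial_self]
      · rw [(Qp_coeff μ δ β γ j i).1 _ (by omega)]; simp
    simp only [this, Polynomial.eval_C]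
    rw [integral_mul_const, Nrm]; ring
  · rw [if_neg h.ne', key j k h]

theorem PData.parseval (D : PData P f μ δ β γ J) {gd : ℕ → ℝ → ℝ} (G : GData P (pq δ β γ) J gd) (i : ℕ)
    (hL2 : Integrable (fun x => pq δ β γ x ^ i * gd i x ^ 2) P) :
    HasSum (fun k => (∫ x, pq δ β γ x ^ (i + k) * gd (i + k) x ∂P) ^ 2 / Nrm P δ β γ i k)
      (∫ x, pq δ β γ x ^ i * gd i x ^ 2 ∂P) := by
  have := D.prob
  set s : ℝ → ℝ := fun x => √(pq δ β γ x ^ i) with hs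
  have hsc : Continuous s := ((pq_cont δ β γ).pow i).sqrt
  have hss : ∀ᵐ x ∂P, s x * s x = pq δ β γ x ^ i := by
    filter_upwards [D.memJ] with x hx
    exact Real.mul_self_sqrt (pow_nonneg (D.qpos x hx).le i)
  have hI : ∀ p : Polynomial ℝ, Integrable (fun x => pq δ β γ x ^ i * p.eval x) P := by
    intro p
    refine (D.polyInt (qpoly δ β γ ^ i * p)).congr (Eventually.of_forall fun x => ?_)
    simp [qpoly_eval]
  have hspoly : ∀ p : Polynomial ℝ, MemLp (fun x => s x * p.eval x) 2 P := by
    intro p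
    refine (memLp_two_iff_integrable_sq (hsc.mul p.continuous).aestronglyMeasurable).2 ?_
    refine (hI (p * p)).congr ?_
    filter_upwards [hss] with x hx
    simp only [Pi.mul_apply]
    rw [Polynomial.eval_mul, ← hx]; ring
  set v : ℝ → ℝ := fun x => s x * gd i x with hv
  have hvL : MemLp v 2 P := by
    refine (memLp_two_iff_integrable_sq (D.aesm (hsc.continuousOn.mul (G.cont i)))).2 ?_
    refine hL2.congr ?_
    filter_upwards [hss] with x hx
    simp only [Pi.mul_apply]; rw [← hx]; ring
  set e : ℕ → ℝ → ℝ := fun k x => (√(Nrm P δ β γ i k))⁻¹ * (s x * (Qp μ δ β γ i k).eval x) with he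
  have heL : ∀ k, MemLp (e k) 2 P := fun k => (hspoly _).const_mul _
  have hN : ∀ k, √(Nrm P δ β γ i k) * √(Nrm P δ β γ i k) = Nrm P δ β γ i k := fun k =>
    Real.mul_self_sqrt (D.Nrm_pos i k).le
  have hN0 : ∀ k, √(Nrm P δ β γ i k) ≠ 0 := fun k => (Real.sqrt_pos.2 (D.Nrm_pos i k)).ne'
  have horth : ∀ j k, ∫ x, e j x * e k x ∂P = if j = k then 1 else 0 := by
    intro j k
    have : ∫ x, e j x * e k x ∂P = (√(Nrm P δ β γ i j))⁻¹ * (√(Nrm P δ β γ i k))⁻¹ *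
        ∫ x, pq δ β γ x ^ i * ((Qp μ δ β γ i j).eval x * (Qp μ δ β γ i k).eval x) ∂P := by
      rw [← integral_const_mul]
      refine integral_congr_ae ?_
      filter_upwards [hss] with x hx
      simp only [he]; rw [← hx]; ring
    rw [this, D.Qorth]
    split_ifs with h
    · subst h
      have h1 := hN0 j
      have h2 := hN j
      rw [← mul_inv, h2, inv_mul_cancel₀ (D.Nrm_pos i j).ne']
    · simp
  have htot : ∀ φ : ℝ → ℝ, MemLp φ 2 P → (∀ k, ∫ x, φ x * e k x ∂P = 0) → φ =ᵐ[P] 0 := by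
    intro φ hφ h0
    obtain ⟨t, ht, hexp⟩ := D.polyExpInt
    have hpInt : ∀ p : Polynomial ℝ, Integrable (fun x => φ x * s x * p.eval x) P := by
      intro p
      refine (hφ.integrable_mul (hspoly p)).congr (Eventually.of_forall fun x => ?_)
      simp only [Pi.mul_apply]; ring
    have hpoly : ∀ d : ℕ, ∀ p : Polynomial ℝ, (∀ m, d ≤ m → p.coeff m = 0) → ∫ x, φ x * s x * p.eval x ∂P = 0 := by
      intro d
      induction d with
      | zero =>
        intro p hp
        have : p = 0 := by ext m; simpa using hp m (Nat.zero_le m)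
        simp [this]
      | succ d ih =>
        intro p hp
        have hLpos : 0 < pp δ (2 * i + d - 1) d := by
          have h1 := D.Nrm_pos i d
          rcases d with _ | d
          · simp [pp]
          · exact pp_pos D.hδ (by push_cast; have : (0:ℝ) ≤ i := Nat.cast_nonneg i; have : (0:ℝ) ≤ d := Nat.cast_nonneg d; linarith) _
        obtain ⟨hQ1, hQ2⟩ := Qp_coeff μ δ β γ d i
        set a := p.coeff d / pp δ (2 * i + d - 1) d with ha
        have h1 := ih (p - Polynomial.C a * Qp μ δ β γ i d) (by
          intro m hm
          rw [Polynomial.coeff_sub, Polynomial.coeff_C_mul]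
          rcases eq_or_lt_of_le hm with rfl | hlt
          · rw [hQ2, ha]; field_simp; ring
          · rw [hQ1 m hlt, hp m hlt]; ring)
        have h2 : ∫ x, φ x * s x * (Qp μ δ β γ i d).eval x ∂P = 0 := by
          have h3 := h0 d
          have : ∫ x, φ x * e d x ∂P = (√(Nrm P δ β γ i d))⁻¹ * ∫ x, φ x * s x * (Qp μ δ β γ i d).eval x ∂P := by
            rw [← integral_const_mul]; congr 1; ext x; simp only [he]; ring
          rw [this] at h3
          exact (mul_eq_zero.1 h3).resolve_left (inv_ne_zero (hN0 d))
        have h4 : ∫ x, φ x * s x * p.eval x ∂P = ∫ x, φ x * s x * (p - Polynomial.C a * Qp μ δ β γ i d).eval x ∂P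
            + a * ∫ x, φ x * s x * (Qp μ δ β γ i d).eval x ∂P := by
          rw [← integral_const_mul, ← integral_add (hpInt _) ((hpInt _).const_mul a)]
          congr 1; ext x
          simp only [Polynomial.eval_sub, Polynomial.eval_mul, Polynomial.eval_C]; ring
        rw [h4, h1, h2]; ring
    have hψ : (fun x => φ x * s x) =ᵐ[P] 0 := by
      refine complete_aux P _ (t / 2) (half_pos ht) (hφ.1.mul hsc.aestronglyMeasurable) ?_ ?_
      · have hes : MemLp (fun x => Real.exp (t / 2 * |x|) * s x) 2 P := by
          rw [memLp_two_iff_integrable_sq (Continuous.aestronglyMeasurable (by fun_prop))]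
          refine (hexp (qpoly δ β γ ^ i)).congr ?_
          filter_upwards [hss] with x hx
          rw [Polynomial.eval_pow, qpoly_eval, ← hx, show t * |x| = t / 2 * |x| + t / 2 * |x| by ring, Real.exp_add]; ring
        refine (hφ.integrable_mul hes).congr (Eventually.of_forall fun x => ?_)
        simp only [Pi.mul_apply]; ring
      · intro k
        have := hpoly (k + 1) (Polynomial.X ^ k) (fun m hm => by rw [Polynomial.coeff_X_pow, if_neg (by omega)])
        simpa using this
    filter_upwards [hψ, D.memJ] with x hx hxJ
    have : s x ≠ 0 := (Real.sqrt_pos.2 (pow_pos (D.qpos x hxJ) i)).ne'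
    exact (mul_eq_zero.1 hx).resolve_right this
  have hP := parseval_aux P v hvL e heL horth htot
  have e1 : ∫ x, v x ^ 2 ∂P = ∫ x, pq δ β γ x ^ i * gd i x ^ 2 ∂P := by
    refine integral_congr_ae ?_
    filter_upwards [hss] with x hx
    simp only [hv]; rw [← hx]; ring
  rw [e1] at hP
  refine hP.congr_fun ?_ |> fun h => h
  intro k
  have e2 : ∫ x, v x * e k x ∂P = (√(Nrm P δ β γ i k))⁻¹ * ∫ x, pq δ β γ x ^ (i + k) * gd (i + k) x ∂P := by
    rw [← D.Qg G, ← integral_const_mul]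
    refine integral_congr_ae ?_
    filter_upwards [hss] with x hx
    simp only [hv, he]; rw [← hx]; ring
  rw [e2, mul_pow, inv_pow, sq (√_), hN]
  field_simp

end

section
variable {P : Measure ℝ} {f : ℝ → ℝ} {μ δ β γ : ℝ} {J : Set ℝ}

theorem pp_add (δ a : ℝ) (i j : ℕ) : pp δ a (i + j) = pp δ a i * pp δ (a + i) j := by
  unfold pp
  rw [Finset.prod_range_add]
  congr 1
  refine Finset.prod_congr rfl fun x _ => ?_
  push_cast; ring

theorem Nrm_ratio (P : Measure ℝ) (δ β γ : ℝ) (i j : ℕ) :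
    Nrm P δ β γ 0 (i + j) = newt δ i (lam δ (i + j)) * Nrm P δ β γ i j := by
  rw [← fall_mul_pp, ← choose_mul_factorial]
  unfold Nrm
  have h1 : ((i + j).factorial : ℝ) = ((i + j).choose i : ℝ) * i.factorial * j.factorial := by
    have := Nat.choose_mul_factorial_mul_factorial (Nat.le_add_right i j)
    rw [Nat.add_sub_cancel_left] at this
    exact_mod_cast this.symm
  rw [h1, pp_add, zero_add]
  have e1 : (2 * ((0 : ℕ) : ℝ) + ((i + j : ℕ) : ℝ) - 1) = ((i + j : ℕ) : ℝ) - 1 := by push_cast; ring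
  have e2 : ((i + j : ℕ) : ℝ) - 1 + i = 2 * (i : ℝ) + j - 1 := by push_cast; ring
  rw [e1, e2]
  ring

theorem newt_lam_zero (δ : ℝ) {i k : ℕ} (h : k < i) : newt δ i (lam δ k) = 0 := by
  unfold newt
  exact Finset.prod_eq_zero (Finset.mem_range.2 h) (sub_self _)

theorem pearson_main
    (P : Measure ℝ) (f : ℝ → ℝ) (μ δ β γ : ℝ) (hδ : δ ≤ 0)
    (hIP : IsIntegratedPearson P f μ δ β γ)
    (α ω : EReal) (hsupp : {x : ℝ | 0 < f x} = erealIoo α ω)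
    (n : ℕ) (hn : 1 ≤ n) (gd : ℕ → ℝ → ℝ)
    (hg : ∀ m : ℕ, MemH P (pq δ β γ) (erealIoo α ω) m n gd) :
    (Even n → Monotone fun m => Sbound P δ (pq δ β γ) m n gd) ∧
    (Odd n → Antitone fun m => Sbound P δ (pq δ β γ) m n gd) ∧
    Tendsto (fun m => Sbound P δ (pq δ β γ) m n gd) atTop
      (nhds (variance (gd 0) P)) := by
  set J := erealIoo α ω with hJ
  have D : PData P f μ δ β γ J := pdata_of hδ hIP hsupp (erealIoo_isOpen α ω)
    (erealIoo_ordConnected α ω) (erealIoo_frontier α ω)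
  have := D.prob
  have der : ∀ k, ∀ x ∈ J, HasDerivAt (gd k) (gd (k + 1) x) x := fun k =>
    (hg (k + 2)).1 k (lt_of_lt_of_le (by omega) (le_max_left _ _))
  have hcont : ∀ k, ContinuousOn (gd k) J := fun k x hx => (der k x hx).continuousAt.continuousWithinAt
  have hIntg : ∀ i, n < i → Integrable (fun x => pq δ β γ x ^ i * gd i x) P := by
    intro i hi
    refine ((hg i).2.2.2.2 i hi le_rfl).mono (D.aesm (((pq_cont δ β γ).pow i).continuousOn.mul (hcont i))) ?_
    exact Eventually.of_forall fun x => by simp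
  have G := D.gdata der n hIntg
  have hL2 : ∀ d i, i + d = n → Integrable (fun x => pq δ β γ x ^ i * gd i x ^ 2) P := by
    intro d
    induction d with
    | zero => intro i hi; simp only [add_zero] at hi; subst hi; exact (hg 0).2.2.2.1
    | succ d ih =>
      intro i hi
      exact D.l2chain i (gd i) (gd (i + 1)) (der i) (hcont _) (ih (i + 1) (by omega))
  set E : ℕ → ℝ := fun k => ∫ x, pq δ β γ x ^ k * gd k x ∂P with hE
  set A : ℕ → ℝ := fun i => ∫ x, pq δ β γ x ^ i * gd i x ^ 2 ∂P with hA
  set c : ℕ → ℝ := fun k => E k ^ 2 / Nrm P δ β γ 0 k with hc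
  have hc0 : ∀ k, 0 ≤ c k := fun k => div_nonneg (sq_nonneg _) (D.Nrm_pos 0 k).le
  have hAs : ∀ i ≤ n, HasSum (fun k => c k * newt δ i (lam δ k)) (A i) := by
    intro i hi
    have h := D.parseval G i (hL2 (n - i) i (by omega))
    rw [← hasSum_nat_add_iff' i, Finset.sum_eq_zero (fun k hk => by
      rw [newt_lam_zero δ (Finset.mem_range.1 hk), mul_zero]), sub_zero]
    have e : (fun k => c (k + i) * newt δ i (lam δ (k + i))) = fun k => (∫ x, pq δ β γ x ^ (i + k) * gd (i + k) x ∂P) ^ 2 / Nrm P δ β γ i k := by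
      ext k
      rw [add_comm k i]
      simp only [hc, hE]
      have h1 := Nrm_ratio P δ β γ i k
      have h2 := (D.Nrm_pos 0 (i + k)).ne'
      have h3 := (D.Nrm_pos i k).ne'
      have h4 : newt δ i (lam δ (i + k)) ≠ 0 := by
        intro h0; rw [h0, zero_mul] at h1; exact h2 h1
      rw [h1]
      field_simp
    rw [e]; exact h
  have hS : ∀ m, Sbound P δ (pq δ β γ) m n gd = ∑ k ∈ Finset.Icc 1 m, c k * rfac δ m n (lam δ k)
      + ∑ i ∈ Finset.Icc 1 n, (-1 : ℝ) ^ (i - 1) * bco δ m n i * A i := by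
    intro m
    unfold Sbound
    congr 1
    refine Finset.sum_congr rfl fun k hk => ?_
    rw [Finset.mem_Icc] at hk
    rw [← aco_eq hδ m n k hk.2]
    simp only [hc, hE, Nrm, zero_add]
    have e1 : (2 * ((0 : ℕ) : ℝ) + (k : ℝ) - 1) = (k : ℝ) - 1 := by push_cast; ring
    rw [e1]
    have h1 := (D.qmom_pos k).ne'
    have h2 : pp δ ((k : ℝ) - 1) k ≠ 0 :=
      (pp_pos hδ (by have : (1 : ℝ) ≤ k := by exact_mod_cast hk.1
                     linarith) k).ne'
    have h3 : (k.factorial : ℝ) ≠ 0 := by positivity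
    field_simp
  have hmain := abstract_main hδ n hn c A hc0 hAs (fun m => Sbound P δ (pq δ β γ) m n gd) hS
  have hvar : variance (gd 0) P = A 0 - c 0 := by
    have hLp : MemLp (gd 0) 2 P := by
      refine (memLp_two_iff_integrable_sq (D.aesm (hcont 0))).2 ?_
      simpa using hL2 n 0 (by omega)
    rw [variance_eq_sub hLp]
    simp [hA, hc, hE, Nrm, pp]
  rw [hvar]
  exact hmain

end

/-- **Remark 3.1.** If `X ∼ IP(μ; δ, β, γ)` with `δ ≤ 0`, `n ≥ 1`, and
`g ∈ H^{∞,n}(X)` (i.e. `g ∈ H^{m,n}(X)` for every `m`), then the sequence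
`(S_{m,n}(g))_m` is non-decreasing in `m` when `n` is even, non-increasing when
`n` is odd, and converges to `Var g(X)` as `m → ∞`. -/
theorem pearson_bound_monotone_tendsto
    (P : Measure ℝ) (f : ℝ → ℝ) (μ δ β γ : ℝ) (hδ : δ ≤ 0)
    (hIP : IsIntegratedPearson P f μ δ β γ)
    (α ω : EReal) (hsupp : {x : ℝ | 0 < f x} = erealIoo α ω)
    (n : ℕ) (hn : 1 ≤ n) (gd : ℕ → ℝ → ℝ)
    (hg : ∀ m : ℕ, MemH P (pq δ β γ) (erealIoo α ω) m n gd) :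
    (Even n → Monotone fun m => Sbound P δ (pq δ β γ) m n gd) ∧
    (Odd n → Antitone fun m => Sbound P δ (pq δ β γ) m n gd) ∧
    Tendsto (fun m => Sbound P δ (pq δ β γ) m n gd) atTop
      (nhds (variance (gd 0) P)) := by
  exact pearson_main P f μ δ β γ hδ hIP α ω hsupp n hn gd hg

end
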